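/- For every λ > 0, as n → ∞ one has ln 𝒩(n, n, ⌊c(λ) n^{2/3}⌋) = n^{2/3}·(e(λ) + o(1)). -/

import Mathlib

open Real Filter Asymptotics MeasureTheory

/-- The set of pairs of coprime nonnegative integers (including `(0,1)` and `(1,0)`). -/
abbrev Xc : Type := {x : ℕ × ℕ // Nat.gcd x.1 x.2 = 1}

/-- The endpoint of the convex chain encoded by a finitely supported `ν : X →₀ ℕ`. -/
def chainEndpoint (ν : Xc →₀ ℕ) : ℕ × ℕ :=
  (ν.sum fun x m => m * x.val.1, ν.sum fun x m => m * x.val.2)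

/-- `𝒩(n₁,n₂,N)`: the number of convex chains with endpoint `(n₁,n₂)` and `N` vertices. -/
noncomputable def numChains (n₁ n₂ N : ℕ) : ℕ :=
  Nat.card {ν : Xc →₀ ℕ // chainEndpoint ν = (n₁, n₂) ∧ ν.support.card = N}

/-- `A(λ) = ζ(3) − Li₃(1−λ)` as an integral over the positive quadrant. -/
noncomputable def Aint (l : ℝ) : ℝ :=
  ∫ t : ℝ × ℝ in Set.Ioi (0:ℝ) ×ˢ Set.Ioi (0:ℝ),
    l * t.1 * Real.exp (-(t.1 + t.2)) /
      ((1 - Real.exp (-(t.1 + t.2))) * (1 + (l - 1) * Real.exp (-(t.1 + t.2))))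

/-- `B(λ) = λ·Li₂(1−λ)/(1−λ)` as an integral over the positive quadrant. -/
noncomputable def Bint (l : ℝ) : ℝ :=
  ∫ t : ℝ × ℝ in Set.Ioi (0:ℝ) ×ˢ Set.Ioi (0:ℝ),
    l * Real.exp (-(t.1 + t.2)) / (1 + (l - 1) * Real.exp (-(t.1 + t.2)))

noncomputable def zeta2 : ℝ := π ^ 2 / 6

noncomputable def cfun (l : ℝ) : ℝ := Bint l / (zeta2 ^ ((1:ℝ)/3) * Aint l ^ ((2:ℝ)/3))

noncomputable def efun (l : ℝ) : ℝ :=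
  3 * (Aint l / zeta2) ^ ((1:ℝ)/3) - cfun l * Real.log l

open Set Topology in
/-- A Riemann sum on a half-line as an integral of a step function. -/
lemma hasSum_integral_ceil (u : ℝ → ℝ) {b : ℝ} (hb : 0 < b)
    (hint : IntegrableOn (fun s => u (b * ⌈s / b⌉₊)) (Ioi 0)) :
    HasSum (fun k : ℕ => b * u (b * (k + 1))) (∫ s in Ioi (0:ℝ), u (b * ⌈s / b⌉₊)) := by
  have hU : Ioi (0:ℝ) = ⋃ k : ℕ, Ioc (b * k) (b * (k + 1)) := by
    ext s
    simp only [mem_Ioi, mem_iUnion, mem_Ioc]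
    constructor
    · intro hs
      have hpos : 0 < ⌈s / b⌉₊ := Nat.ceil_pos.2 (by positivity)
      refine ⟨⌈s / b⌉₊ - 1, ?_, ?_⟩
      · have := Nat.ceil_lt_add_one (a := s / b) (by positivity)
        rw [Nat.cast_sub hpos, Nat.cast_one]
        rw [← lt_div_iff₀' hb]; linarith
      · rw [Nat.cast_sub hpos, Nat.cast_one, ← div_le_iff₀' hb]
        have := Nat.le_ceil (s / b)
        linarith
    · rintro ⟨k, h1, -⟩
      exact lt_of_le_of_lt (by positivity) h1
  have hdisj : Pairwise (Function.onFun Disjoint fun k : ℕ => Ioc (b * k) (b * ((k:ℝ) + 1))) := by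
    have hm : Monotone fun k : ℕ => b * (k : ℝ) := fun i j hij => by
      have : (i : ℝ) ≤ j := by exact_mod_cast hij
      simp only; gcongr
    have := hm.pairwise_disjoint_on_Ioc_succ
    simpa using this
  have h := hasSum_integral_iUnion (μ := volume) (f := fun s => u (b * ⌈s / b⌉₊))
    (fun k : ℕ => measurableSet_Ioc (a := b * (k:ℝ)) (b := b * ((k:ℝ) + 1))) hdisj (hU ▸ hint)
  rw [← hU] at h
  refine (funext fun k => ?_ : (fun k : ℕ => b * u (b * (k + 1))) = _) ▸ h
  rw [setIntegral_congr_fun (g := fun _ => u (b * (k + 1))) measurableSet_Ioc]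
  · simp only [setIntegral_const, smul_eq_mul]
    rw [Measure.real, Real.volume_Ioc, ENNReal.toReal_ofReal (by nlinarith)]
    ring
  · intro s hs
    have : ⌈s / b⌉₊ = k + 1 := by
      rw [Nat.ceil_eq_iff (by simp)]
      constructor
      · rw [lt_div_iff₀' hb]; simpa using hs.1
      · rw [div_le_iff₀' hb]; simpa using hs.2
    simp [this]

open Set Topology in
lemma riemann_bound {u : ℝ → ℝ} {C : ℝ} (hC : ∀ s > 0, |u s| ≤ C * exp (-s / 2)) {b : ℝ}
    (hb : 0 < b) :
    Summable (fun k : ℕ+ => |u (b * k)|) ∧ b * ∑' k : ℕ+, |u (b * k)| ≤ 2 * C := by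
  have hq : exp (-b / 2) < 1 := by rw [Real.exp_lt_one_iff]; linarith
  have hq0 : 0 < exp (-b / 2) := exp_pos _
  have hC0 : 0 ≤ C := by
    have := (abs_nonneg _).trans (hC 1 one_pos)
    exact nonneg_of_mul_nonneg_left this (exp_pos _)
  have hle : ∀ k : ℕ, |u (b * ((k + 1 : ℕ) : ℝ))| ≤ C * exp (-b / 2) * exp (-b / 2) ^ k := by
    intro k
    refine (hC _ (by positivity)).trans_eq ?_
    rw [mul_assoc, ← pow_succ', ← Real.exp_nat_mul]
    congr 2; ring
  have hg : Summable (fun k : ℕ => C * exp (-b / 2) * exp (-b / 2) ^ k) :=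
    (summable_geometric_of_lt_one hq0.le hq).mul_left _
  have hs : Summable (fun k : ℕ => |u (b * ((k + 1 : ℕ) : ℝ))|) :=
    hg.of_nonneg_of_le (fun _ => abs_nonneg _) hle
  constructor
  · exact (summable_pnat_iff_summable_succ (f := fun k : ℕ => |u (b * k)|)).2 hs
  · rw [tsum_pnat_eq_tsum_succ (f := fun k : ℕ => |u (b * k)|)]
    have h1 := hs.tsum_le_tsum hle hg
    rw [tsum_mul_left, tsum_geometric_of_lt_one hq0.le hq] at h1
    have h2 : b / 2 * exp (-b / 2) ≤ 1 - exp (-b / 2) := by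
      have := Real.add_one_le_exp (b / 2)
      have h3 : exp (-b / 2) * exp (b / 2) = 1 := by rw [← Real.exp_add]; simp [neg_div]
      nlinarith
    have h3 : 0 < 1 - exp (-b / 2) := by linarith
    calc b * ∑' k : ℕ, |u (b * ((k + 1 : ℕ) : ℝ))|
        ≤ b * (C * exp (-b / 2) * (1 - exp (-b / 2))⁻¹) := by gcongr
      _ = 2 * C * ((b / 2 * exp (-b / 2)) / (1 - exp (-b / 2))) := by ring
      _ ≤ 2 * C * 1 := by
        gcongr
        exact (div_le_one h3).2 h2
      _ = 2 * C := by ring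

open Set Topology in
lemma riemann_tendsto {u : ℝ → ℝ} {C : ℝ} (hu : ContinuousOn u (Ioi 0))
    (hC : ∀ s > 0, |u s| ≤ C * exp (-s / 2)) :
    Tendsto (fun b : ℝ => b * ∑' k : ℕ+, u (b * k)) (𝓝[>] 0) (𝓝 (∫ s in Ioi (0:ℝ), u s)) := by
  have hC0 : 0 ≤ C := by
    have := (abs_nonneg _).trans (hC 1 one_pos)
    exact nonneg_of_mul_nonneg_left this (exp_pos _)
  have hdom : IntegrableOn (fun s : ℝ => C * exp (-s / 2)) (Ioi 0) := by
    have := (integrableOn_exp_mul_Ioi (a := -(1/2)) (by norm_num) 0).const_mul C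
    refine (integrableOn_congr_fun (fun s _ => ?_) measurableSet_Ioi).1 this
    congr 2; ring
  have hmeas : ∀ b : ℝ, Measurable fun s : ℝ => u (b * ⌈s / b⌉₊) := fun b =>
    (measurable_from_nat (f := fun n : ℕ => u (b * n))).comp
      (Nat.measurable_ceil.comp (measurable_id.div_const b))
  have hbd : ∀ b : ℝ, 0 < b → ∀ s ∈ Ioi (0:ℝ), ‖u (b * ⌈s / b⌉₊)‖ ≤ C * exp (-s / 2) := by
    intro b hb s hs
    have hs : 0 < s := hs
    have h1 : s ≤ b * ⌈s / b⌉₊ := by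
      rw [← div_le_iff₀' hb]; exact Nat.le_ceil _
    refine (hC _ (lt_of_lt_of_le hs h1)).trans ?_
    gcongr
  have key : Tendsto (fun b : ℝ => ∫ s in Ioi (0:ℝ), u (b * ⌈s / b⌉₊)) (𝓝[>] 0)
      (𝓝 (∫ s in Ioi (0:ℝ), u s)) := by
    refine tendsto_integral_filter_of_dominated_convergence (fun s => C * exp (-s / 2)) ?_ ?_ hdom ?_
    · exact Eventually.of_forall fun b => (hmeas b).aestronglyMeasurable
    · filter_upwards [self_mem_nhdsWithin] with b hb
      exact (ae_restrict_iff' measurableSet_Ioi).2 (Eventually.of_forall (hbd b hb))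
    · refine (ae_restrict_iff' measurableSet_Ioi).2 (Eventually.of_forall fun s hs => ?_)
      have hc : ContinuousAt u s := hu.continuousAt (Ioi_mem_nhds hs)
      refine hc.tendsto.comp ?_
      have hs : 0 < s := hs
      have h0 : Tendsto (fun b : ℝ => s + b) (𝓝[>] 0) (𝓝 s) := by
        have : Tendsto (fun b : ℝ => s + b) (𝓝 0) (𝓝 (s + 0)) := tendsto_const_nhds.add tendsto_id
        rw [add_zero] at this
        exact this.mono_left nhdsWithin_le_nhds
      refine tendsto_of_tendsto_of_tendsto_of_le_of_le' tendsto_const_nhds h0 ?_ ?_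
      · filter_upwards [self_mem_nhdsWithin] with b hb
        have hb : 0 < b := hb
        rw [← div_le_iff₀' hb]; exact Nat.le_ceil _
      · filter_upwards [self_mem_nhdsWithin] with b hb
        have hb : 0 < b := hb
        have := (Nat.ceil_lt_add_one (a := s / b) (by positivity)).le
        calc b * (⌈s / b⌉₊ : ℝ) ≤ b * (s / b + 1) := by gcongr
          _ = s + b := by field_simp
  refine key.congr' ?_
  filter_upwards [self_mem_nhdsWithin] with b hb
  have hb : 0 < b := hb
  have hint : IntegrableOn (fun s => u (b * ⌈s / b⌉₊)) (Ioi 0) :=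
    hdom.mono' (hmeas b).aestronglyMeasurable
      ((ae_restrict_iff' measurableSet_Ioi).2 (Eventually.of_forall (hbd b hb)))
  rw [← (hasSum_integral_ceil u hb hint).tsum_eq, tsum_mul_left,
    tsum_pnat_eq_tsum_succ (f := fun k : ℕ => u (b * k))]
  push_cast
  rfl

/-- The sum of the two coordinates of a primitive vector. -/
def Xc.size (x : Xc) : ℕ := x.1.1 + x.1.2

lemma Xc.size_pos (x : Xc) : 0 < x.size := by
  rcases x with ⟨⟨a, b⟩, h⟩
  simp only [Xc.size]
  rcases Nat.eq_zero_or_pos (a + b) with h0 | h0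
  · obtain ⟨rfl, rfl⟩ : a = 0 ∧ b = 0 := by omega
    simp at h
  · exact h0

/-- The primitive vectors of given size correspond to the residues coprime to that size. -/
def Xc.sizeFiberEquiv (m : ℕ) :
    {x : Xc // x.size = m} ≃ {j : ℕ // j ∈ (Finset.range (m + 1)).filter (Nat.Coprime m)} where
  toFun x := ⟨x.1.1.1, by
    obtain ⟨⟨⟨a, b⟩, h⟩, hm⟩ := x
    simp only [Xc.size] at hm
    subst hm
    simp only [Finset.mem_filter, Finset.mem_range]
    refine ⟨by omega, ?_⟩
    rw [Nat.coprime_comm]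
    simpa [Nat.Coprime] using h⟩
  invFun j := ⟨⟨(j.1, m - j.1), by
    have h := j.2
    simp only [Finset.mem_filter, Finset.mem_range] at h
    simp only
    rw [Nat.gcd_sub_self_right (by omega)]
    exact Nat.coprime_comm.1 h.2⟩, by
    have h := j.2
    simp only [Finset.mem_filter, Finset.mem_range] at h
    simp only [Xc.size]
    omega⟩
  left_inv := by
    rintro ⟨⟨⟨a, b⟩, h⟩, hm⟩
    simp only [Xc.size] at hm
    subst hm
    simp
  right_inv := by
    rintro ⟨j, hj⟩
    rfl

instance Xc.finite_sizeFiber (m : ℕ) : Finite {x : Xc // x.size = m} :=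
  Finite.of_equiv _ (Xc.sizeFiberEquiv m).symm

lemma Xc.card_sizeFiber (m : ℕ) :
    Nat.card {x : Xc // x.size = m} = m.totient + if m = 1 then 1 else 0 := by
  rw [Nat.card_congr (Xc.sizeFiberEquiv m), Nat.card_eq_fintype_card, Fintype.card_coe,
    Finset.range_add_one, Finset.filter_insert]
  have : Nat.Coprime m m ↔ m = 1 := by simp
  by_cases h : m = 1
  · subst h; simp
  · rw [if_neg (by simpa using h), if_neg h, Nat.totient, add_zero]

lemma Xc.card_sizeFiber_le (m : ℕ) : Nat.card {x : Xc // x.size = m} ≤ 2 * m := by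
  rw [Xc.card_sizeFiber]
  have := Nat.totient_le m
  split_ifs <;> omega

lemma Xc.hasSum_size {f : ℕ → ℝ} (hf : ∀ m, 0 ≤ f m)
    (hs : Summable fun m : ℕ+ => (Nat.totient m : ℝ) * f m) :
    HasSum (fun x : Xc => f x.size) (f 1 + ∑' m : ℕ+, (Nat.totient m : ℝ) * f m) := by
  have hfib : ∀ m : ℕ, ∑' y : {x : Xc // x.size = m}, f y.1.size
      = (Nat.totient m : ℝ) * f m + if m = 1 then f 1 else 0 := by
    intro m
    rw [tsum_congr (fun y : {x : Xc // x.size = m} => by rw [y.2] : ∀ y, _ = f m), tsum_const,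
      Xc.card_sizeFiber, nsmul_eq_mul]
    split_ifs with h
    · subst h; push_cast; ring
    · push_cast; ring
  have hs' : Summable fun m : ℕ => (Nat.totient m : ℝ) * f m := by
    rw [← summable_nat_add_iff 1]
    exact (summable_pnat_iff_summable_succ (f := fun m : ℕ => (Nat.totient m : ℝ) * f m)).1 hs
  have hd : HasSum (fun m : ℕ => if m = 1 then f 1 else 0) (f 1) := by
    simpa using hasSum_ite_eq (1 : ℕ) (f 1)
  have hsum : HasSum (fun m : ℕ => (Nat.totient m : ℝ) * f m + if m = 1 then f 1 else 0)
      (f 1 + ∑' m : ℕ+, (Nat.totient m : ℝ) * f m) := by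
    rw [add_comm (f 1), tsum_pnat_eq_tsum_succ (f := fun m : ℕ => (Nat.totient m : ℝ) * f m)]
    convert! hs'.hasSum.add hd using 2
    rw [hs'.tsum_eq_zero_add]
    simp
  let e := Equiv.sigmaFiberEquiv Xc.size
  have hsm : Summable fun y : (Σ m, {x : Xc // x.size = m}) => f (y.2.1.size) := by
    rw [summable_sigma_of_nonneg (fun _ => hf _)]
    refine ⟨fun m => Summable.of_finite, ?_⟩
    simp only [hfib]
    exact hsum.summable
  have h1 := hsm.hasSum
  rw [hsm.tsum_sigma] at h1
  simp only [hfib] at h1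
  rw [hsum.tsum_eq] at h1
  exact (e.hasSum_iff (f := fun x : Xc => f x.size)).1 h1

open ArithmeticFunction in
lemma summable_moebius_div_sq :
    Summable (fun d : ℕ+ => ((moebius d : ℤ) : ℝ) / (d : ℝ) ^ 2) ∧
      ∑' d : ℕ+, ((moebius d : ℤ) : ℝ) / (d : ℝ) ^ 2 = 1 / zeta2 := by
  have h2 : (1 : ℝ) < (2 : ℂ).re := by norm_num
  have hm := (LSeriesSummable_moebius_iff.mpr h2).LSeriesHasSum
  have hval : LSeries (fun n => ((moebius n : ℤ) : ℂ)) 2 = ((1 / zeta2 : ℝ) : ℂ) := by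
    have h := LSeries_one_mul_Lseries_moebius h2
    rw [LSeries_one_eq_riemannZeta h2, riemannZeta_two] at h
    have h3 : ((zeta2 : ℝ) : ℂ) = (π : ℂ) ^ 2 / 6 := by simp [zeta2]
    rw [← h3] at h
    have h4 : ((zeta2 : ℝ) : ℂ) ≠ 0 := left_ne_zero_of_mul_eq_one h
    push_cast
    field_simp
    rw [mul_comm]; exact h
  rw [LSeriesHasSum, hval] at hm
  have hterm : (fun n : ℕ => LSeries.term (fun n => ((moebius n : ℤ) : ℂ)) 2 n)
      = fun n : ℕ => ((((moebius n : ℤ) : ℝ) / (n : ℝ) ^ 2 : ℝ) : ℂ) := by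
    ext n
    rcases eq_or_ne n 0 with rfl | hn
    · simp
    · rw [LSeries.term_of_ne_zero hn]
      push_cast
      congr 1
      norm_cast
  have hm' : HasSum (fun n : ℕ => (((moebius n : ℤ) : ℝ) / (n : ℝ) ^ 2)) (1 / zeta2) := by
    rw [← Complex.hasSum_ofReal, ← hterm]
    exact hm
  have hs := hm'.summable
  constructor
  · rw [← summable_nat_add_iff 1] at hs
    exact (summable_pnat_iff_summable_succ
      (f := fun n : ℕ => (((moebius n : ℤ) : ℝ) / (n : ℝ) ^ 2))).2 hs
  · rw [tsum_pnat_eq_tsum_succ (f := fun n : ℕ => (((moebius n : ℤ) : ℝ) / (n : ℝ) ^ 2)),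
      ← hm'.tsum_eq, hs.tsum_eq_zero_add]
    simp

open ArithmeticFunction in
lemma totient_eq_sum_moebius (m : ℕ) (hm : 0 < m) :
    (Nat.totient m : ℝ) = ∑ x ∈ m.divisorsAntidiagonal, ((moebius x.1 : ℤ) : ℝ) * x.2 := by
  refine ((sum_eq_iff_sum_mul_moebius_eq (R := ℝ) (f := fun n => (Nat.totient n : ℝ))
    (g := fun n => (n : ℝ))).1 (fun n _ => ?_) m hm).symm
  exact_mod_cast Nat.sum_totient n

lemma summable_pnat_one_div_sq : Summable fun d : ℕ+ => 1 / (d : ℝ) ^ 2 := by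
  have h : Summable fun n : ℕ => 1 / ((n + 1 : ℕ) : ℝ) ^ 2 :=
    (summable_nat_add_iff 1).2 (Real.summable_one_div_nat_pow.2 (by norm_num))
  exact (summable_pnat_iff_summable_succ (f := fun n : ℕ => 1 / (n : ℝ) ^ 2)).2 h

open ArithmeticFunction in
lemma totient_riemann_sum {u : ℝ → ℝ} {C : ℝ} (h0 : ∀ s > 0, 0 ≤ u s)
    (hC : ∀ s > 0, u s ≤ C * exp (-s / 2)) {b : ℝ} (hb : 0 < b) :
    HasSum (fun m : ℕ+ => (Nat.totient m : ℝ) * (u (b * m) / (b * m)))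
      (∑' d : ℕ+, ((moebius d : ℤ) : ℝ) / (b * d) * ∑' k : ℕ+, u (b * d * k)) := by
  have hC' : ∀ s > 0, |u s| ≤ C * exp (-s / 2) := fun s hs => by
    rw [abs_of_nonneg (h0 s hs)]; exact hC s hs
  let F : ℕ+ × ℕ+ → ℝ := fun p => ((moebius p.1 : ℤ) : ℝ) / (b * p.1) * u (b * p.1 * p.2)
  have hbd : ∀ d : ℕ+, 0 < b * d := fun d => mul_pos hb (by exact_mod_cast d.pos)
  have hF : Summable F := by
    refine Summable.of_norm_bounded (g := fun p : ℕ+ × ℕ+ => 1 / (b * p.1) * |u (b * p.1 * p.2)|)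
      ?_ ?_
    · refine (summable_prod_of_nonneg fun p => ?_).2 ⟨fun d => ?_, ?_⟩
      · have := hbd p.1
        simp only [Pi.zero_apply]
        positivity
      · exact (riemann_bound hC' (hbd d)).1.mul_left (1 / (b * d))
      · simp only [tsum_mul_left]
        have hs2 : Summable fun d : ℕ+ => 2 * C / b ^ 2 * (1 / (d : ℝ) ^ 2) := by
          exact summable_pnat_one_div_sq.mul_left _
        refine hs2.of_nonneg_of_le (fun d => ?_) (fun d => ?_)
        · have := hbd d
          exact mul_nonneg (by positivity) (tsum_nonneg fun _ => abs_nonneg _)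
        · have h := (riemann_bound hC' (hbd d)).2
          have h3 := hbd d
          rw [← le_div_iff₀' h3] at h
          calc 1 / (b * d) * ∑' k : ℕ+, |u (b * d * k)|
              ≤ 1 / (b * d) * (2 * C / (b * d)) := by gcongr
            _ = _ := by field_simp
    · intro p
      have := hbd p.1
      simp only [F, norm_mul, norm_div]
      rw [← norm_mul b, Real.norm_eq_abs (b * p.1), abs_of_pos this, Real.norm_eq_abs,
        Real.norm_eq_abs]
      gcongr
      exact_mod_cast ArithmeticFunction.abs_moebius_le_one
  have hG := (sigmaAntidiagonalEquivProd.summable_iff (f := F)).2 hF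
  have h1 := hG.hasSum.sigma (fun m => (hG.sigma_factor m).hasSum)
  have hv : ∑' x, (F ∘ sigmaAntidiagonalEquivProd) x
      = ∑' d : ℕ+, ((moebius d : ℤ) : ℝ) / (b * d) * ∑' k : ℕ+, u (b * d * k) := by
    rw [Function.comp_def, sigmaAntidiagonalEquivProd.tsum_eq F, hF.tsum_prod]
    simp only [F, tsum_mul_left]
  rw [hv] at h1
  convert! h1 using 2 with m
  rw [tsum_fintype, totient_eq_sum_moebius m m.pos, Finset.sum_mul,
    Finset.sum_coe_sort_eq_attach, ← Finset.sum_attach]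
  refine Finset.sum_congr rfl fun x _ => ?_
  have hx : x.1.1 * x.1.2 = (m : ℕ) := (Nat.mem_divisorsAntidiagonal.1 x.2).1
  have hx2 : 0 < x.1.2 := Nat.pos_of_ne_zero fun h => by simp [h] at hx; exact m.pos.ne hx
  have hxr : (x.1.1 : ℝ) * x.1.2 = (m : ℕ) := by exact_mod_cast hx
  simp only [F, Function.comp, sigmaAntidiagonalEquivProd, Equiv.coe_fn_mk,
    divisorsAntidiagonalFactors, PNat.mk_coe]
  rw [mul_assoc b, hxr, ← hxr]
  field_simp

open ArithmeticFunction Topology in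
/-- Sums over primitive vectors of a function of the scaled size. -/
theorem Xc.tendsto_sum {u : ℝ → ℝ} {C : ℝ} (hu : ContinuousOn u (Set.Ioi 0))
    (h0 : ∀ s > 0, 0 ≤ u s) (hC : ∀ s > 0, u s ≤ C * exp (-s / 2)) :
    (∀ b > 0, Summable fun x : Xc => u (b * x.size) / (b * x.size)) ∧
    Tendsto (fun b : ℝ => b ^ 2 * ∑' x : Xc, u (b * x.size) / (b * x.size)) (𝓝[>] 0)
      (𝓝 ((∫ s in Set.Ioi (0:ℝ), u s) / zeta2)) := by
  have hC' : ∀ s > 0, |u s| ≤ C * exp (-s / 2) := fun s hs => by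
    rw [abs_of_nonneg (h0 s hs)]; exact hC s hs
  have hC0 : 0 ≤ C := nonneg_of_mul_nonneg_left ((h0 1 one_pos).trans (hC 1 one_pos)) (exp_pos _)
  have hX : ∀ b > 0, HasSum (fun x : Xc => u (b * x.size) / (b * x.size))
      (u b / b + ∑' d : ℕ+, ((moebius d : ℤ) : ℝ) / (b * d) * ∑' k : ℕ+, u (b * d * k)) := by
    intro b hb
    have h := totient_riemann_sum h0 hC hb
    have h2 := Xc.hasSum_size (f := fun m : ℕ => u (b * m) / (b * m)) (fun m => ?_) h.summable
    · rw [h.tsum_eq] at h2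
      simpa using h2
    · rcases Nat.eq_zero_or_pos m with rfl | hm
      · simp
      · have : 0 < b * m := by positivity
        exact div_nonneg (h0 _ this) this.le
  refine ⟨fun b hb => (hX b hb).summable, ?_⟩
  have hmain : Tendsto (fun b : ℝ => ∑' d : ℕ+, ((moebius d : ℤ) : ℝ) / (d : ℝ) ^ 2 *
      ((b * d) * ∑' k : ℕ+, u (b * d * k))) (𝓝[>] 0)
      (𝓝 (∑' d : ℕ+, ((moebius d : ℤ) : ℝ) / (d : ℝ) ^ 2 * ∫ s in Set.Ioi (0:ℝ), u s)) := by
    refine tendsto_tsum_of_dominated_convergence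
      (bound := fun d : ℕ+ => 1 / (d : ℝ) ^ 2 * (2 * C)) ?_ ?_ ?_
    · exact summable_pnat_one_div_sq.mul_right _
    · intro d
      have hd : (0 : ℝ) < d := by exact_mod_cast d.pos
      refine Tendsto.const_mul _ ((riemann_tendsto hu hC').comp ?_)
      refine tendsto_nhdsWithin_iff.2 ⟨?_, ?_⟩
      · have : Tendsto (fun b : ℝ => b * d) (𝓝 0) (𝓝 (0 * d)) := tendsto_id.mul_const _
        rw [zero_mul] at this
        exact this.mono_left nhdsWithin_le_nhds
      · filter_upwards [self_mem_nhdsWithin] with b hb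
        exact mul_pos hb hd
    · filter_upwards [self_mem_nhdsWithin] with b hb d
      have hd : (0 : ℝ) < d := by exact_mod_cast d.pos
      have hbd : 0 < b * d := mul_pos hb hd
      have h := riemann_bound hC' hbd
      rw [norm_mul, norm_div]
      gcongr ?_ * ?_
      · rw [Real.norm_eq_abs, Real.norm_eq_abs, abs_of_pos (by positivity : (0:ℝ) < (d:ℝ) ^ 2)]
        gcongr
        exact_mod_cast ArithmeticFunction.abs_moebius_le_one
      · refine le_trans ?_ h.2
        rw [Real.norm_eq_abs, abs_mul, abs_of_pos hbd]
        gcongr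
        simpa using norm_tsum_le_tsum_norm (f := fun k : ℕ+ => u (b * d * k)) (by simpa using h.1)
  rw [tsum_mul_right, summable_moebius_div_sq.2] at hmain
  have hcor : Tendsto (fun b : ℝ => b * u b) (𝓝[>] 0) (𝓝 0) := by
    have h1 : Tendsto (fun b : ℝ => b * C) (𝓝[>] 0) (𝓝 0) := by
      have : Tendsto (fun b : ℝ => b * C) (𝓝 0) (𝓝 (0 * C)) := tendsto_id.mul_const _
      rw [zero_mul] at this
      exact this.mono_left nhdsWithin_le_nhds
    refine squeeze_zero' ?_ ?_ h1
    · filter_upwards [self_mem_nhdsWithin] with b hb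
      exact mul_nonneg (le_of_lt hb) (h0 b hb)
    · filter_upwards [self_mem_nhdsWithin] with b hb
      have hb : 0 < b := hb
      gcongr
      refine (hC b hb).trans ?_
      refine mul_le_of_le_one_right hC0 (Real.exp_le_one_iff.2 (by linarith))
  have := hcor.add hmain
  rw [zero_add, one_div_mul_eq_div] at this
  refine this.congr' ?_
  filter_upwards [self_mem_nhdsWithin] with b hb
  have hb : 0 < b := hb
  rw [(hX b hb).tsum_eq, mul_add, ← tsum_mul_left]
  congr 1
  · field_simp
  · refine tsum_congr fun d => ?_
    have hd : (0 : ℝ) < d := by exact_mod_cast d.pos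
    field_simp

/-- Probability that a primitive vector of weight `q` is used. -/
noncomputable def occP (l q : ℝ) : ℝ := l * q / (1 + (l - 1) * q)

/-- Mean multiplicity of a primitive vector of weight `q`. -/
noncomputable def meanN (l q : ℝ) : ℝ := l * q / ((1 - q) * (1 + (l - 1) * q))

/-- Second moment of the multiplicity of a primitive vector of weight `q`. -/
noncomputable def secM (l q : ℝ) : ℝ := l * q * (1 + q) / ((1 - q) ^ 2 * (1 + (l - 1) * q))

/-- Logarithm of the partition function of a primitive vector of weight `q`. -/
noncomputable def logZ (l q : ℝ) : ℝ := Real.log (1 + l * q / (1 - q))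

section Weights

variable {l q : ℝ} (hl : 0 < l) (hq0 : 0 < q) (hq1 : q < 1)
include hl hq0 hq1

lemma one_add_mul_pos : 0 < 1 + (l - 1) * q := by nlinarith [mul_pos hl hq0]

omit hl in
lemma min_le_one_add_mul : min 1 l ≤ 1 + (l - 1) * q := by
  rcases le_total 1 l with h | h
  · rw [min_eq_left h]; nlinarith
  · rw [min_eq_right h]; nlinarith

lemma occP_pos : 0 < occP l q := by
  have := one_add_mul_pos hl hq0 hq1
  unfold occP; positivity

lemma one_sub_occP : 1 - occP l q = (1 - q) / (1 + (l - 1) * q) := by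
  have := one_add_mul_pos hl hq0 hq1
  unfold occP
  rw [eq_div_iff this.ne', sub_mul, div_mul_cancel₀ _ this.ne']
  ring

lemma occP_lt_one : occP l q < 1 := by
  have h1 := one_add_mul_pos hl hq0 hq1
  have h2 := one_sub_occP hl hq0 hq1
  have : 0 < (1 - q) / (1 + (l - 1) * q) := div_pos (by linarith) h1
  linarith

omit hl hq0 hq1 in
lemma meanN_eq : meanN l q = occP l q / (1 - q) := by
  rw [meanN, occP, div_div, mul_comm (1 - q)]

lemma meanN_pos : 0 < meanN l q := by
  rw [meanN_eq]
  exact div_pos (occP_pos hl hq0 hq1) (by linarith)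

lemma secM_pos : 0 < secM l q := by
  have h1 := one_add_mul_pos hl hq0 hq1
  unfold secM; positivity

lemma logZ_nonneg : 0 ≤ logZ l q := by
  exact Real.log_nonneg (by linarith [show 0 < l * q / (1 - q) by positivity])

end Weights

lemma cube_mul_exp_le {s : ℝ} (hs : 0 < s) : (1 + s) ^ 3 * exp (-s) ≤ 96 * exp (-s / 2) := by
  have h1 := Real.pow_div_factorial_le_exp (x := (1 + s) / 2) (by positivity) 3
  have h2 : exp ((1 + s) / 2) = exp (1 / 2) * exp (s / 2) := by rw [← Real.exp_add]; ring_nf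
  have h3 : exp (1 / 2 : ℝ) ≤ 2 := by
    have h4 : exp (1 / 2 : ℝ) ^ 2 = exp 1 := by rw [← Real.exp_nat_mul]; norm_num
    have := Real.exp_one_lt_d9
    nlinarith [exp_pos (1 / 2 : ℝ)]
  have h5 : (1 + s) ^ 3 ≤ 96 * exp (s / 2) := by
    have h6 : ((3).factorial : ℝ) = 6 := by norm_num [Nat.factorial]
    rw [h6, h2] at h1
    have : exp (1 / 2) * exp (s / 2) ≤ 2 * exp (s / 2) := by gcongr
    have h7 : ((1 + s) / 2) ^ 3 / 6 = (1 + s) ^ 3 / 48 := by ring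
    rw [h7] at h1
    linarith
  calc (1 + s) ^ 3 * exp (-s) ≤ 96 * exp (s / 2) * exp (-s) := by gcongr
    _ = 96 * exp (-s / 2) := by rw [mul_assoc, ← Real.exp_add]; ring_nf

lemma le_one_sub_exp_mul {s : ℝ} : s ≤ (1 - exp (-s)) * (1 + s) := by
  have h := Real.add_one_le_exp s
  have h2 : exp (-s) * exp s = 1 := by rw [← Real.exp_add]; simp
  nlinarith [exp_pos (-s)]

lemma exists_weight_bounds {l : ℝ} (hl : 0 < l) : ∃ C : ℝ, ∀ s > 0,
    s * occP l (exp (-s)) ≤ C * exp (-s / 2) ∧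
    s ^ 2 * meanN l (exp (-s)) ≤ C * exp (-s / 2) ∧
    s * logZ l (exp (-s)) ≤ C * exp (-s / 2) ∧
    s ^ 3 * secM l (exp (-s)) ≤ C * exp (-s / 2) := by
  refine ⟨96 * (2 * (l / min 1 l) + l), fun s hs => ?_⟩
  set q := exp (-s) with hq
  have hq0 : 0 < q := exp_pos _
  have hq1 : q < 1 := by rw [hq, Real.exp_lt_one_iff]; linarith
  have h1q : 0 < 1 - q := by linarith
  have hDm := min_le_one_add_mul (l := l) hq0 hq1
  have hs1 : s / (1 - q) ≤ 1 + s := by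
    rw [div_le_iff₀' h1q]; exact le_one_sub_exp_mul
  have hlD : l / (1 + (l - 1) * q) ≤ l / min 1 l := by gcongr
  set c := l / min 1 l
  have hc0 : 0 < c := by positivity
  have hE := cube_mul_exp_le hs
  rw [← hq] at hE
  have hpow1 : (1 + s) ≤ (1 + s) ^ 3 := by nlinarith [sq_nonneg s, mul_pos hs hs, pow_pos hs 3]
  have hfin : ∀ y K : ℝ, 0 ≤ K → K ≤ 2 * c + l → y ≤ K * ((1 + s) ^ 3 * q) →
      y ≤ 96 * (2 * c + l) * exp (-s / 2) := by
    intro y K hK0 hK h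
    calc y ≤ K * ((1 + s) ^ 3 * q) := h
      _ ≤ (2 * c + l) * (96 * exp (-s / 2)) := by gcongr
      _ = _ := by ring
  refine ⟨hfin _ c hc0.le (by linarith) ?_, hfin _ c hc0.le (by linarith) ?_,
    hfin _ l hl.le (by linarith) ?_, hfin _ (2 * c) (by linarith) (by linarith) ?_⟩
  · calc s * occP l q = (l / (1 + (l - 1) * q)) * (s * q) := by unfold occP; ring
      _ ≤ c * ((1 + s) ^ 3 * q) := by gcongr; linarith
  · calc s ^ 2 * meanN l q = (l / (1 + (l - 1) * q)) * (s * (s / (1 - q)) * q) := by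
          unfold meanN; field_simp
      _ ≤ c * ((1 + s) * (1 + s) * q) := by gcongr; linarith
      _ ≤ c * ((1 + s) ^ 3 * q) := by
          gcongr; nlinarith [mul_pos hs hs, pow_pos hs 3]
  · have hlog : logZ l q ≤ l * q / (1 - q) := by
      have := Real.log_le_sub_one_of_pos (x := 1 + l * q / (1 - q)) (by positivity)
      unfold logZ; linarith
    calc s * logZ l q ≤ s * (l * q / (1 - q)) := by gcongr
      _ = l * ((s / (1 - q)) * q) := by ring
      _ ≤ l * ((1 + s) * q) := by gcongr
      _ ≤ l * ((1 + s) ^ 3 * q) := by gcongr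
  · calc s ^ 3 * secM l q
        = (l / (1 + (l - 1) * q)) * (s * (s / (1 - q)) ^ 2 * q) * (1 + q) := by
          unfold secM; field_simp
      _ ≤ c * ((1 + s) * (1 + s) ^ 2 * q) * 2 := by gcongr <;> linarith
      _ = 2 * c * ((1 + s) ^ 3 * q) := by ring

lemma exp_neg_lt_one {s : ℝ} (hs : 0 < s) : exp (-s) < 1 := by
  rw [Real.exp_lt_one_iff]; linarith

section Continuity

variable {l : ℝ} (hl : 0 < l)
include hl

lemma continuousOn_occP : ContinuousOn (fun s => occP l (exp (-s))) (Set.Ioi 0) := by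
  unfold occP
  refine ContinuousOn.div (by fun_prop) (by fun_prop) fun s hs => ?_
  exact (one_add_mul_pos hl (exp_pos _) (exp_neg_lt_one hs)).ne'

lemma continuousOn_meanN : ContinuousOn (fun s => meanN l (exp (-s))) (Set.Ioi 0) := by
  unfold meanN
  refine ContinuousOn.div (by fun_prop) (by fun_prop) fun s hs => ?_
  exact mul_ne_zero (sub_ne_zero.2 (exp_neg_lt_one hs).ne')
    (one_add_mul_pos hl (exp_pos _) (exp_neg_lt_one hs)).ne'

lemma continuousOn_secM : ContinuousOn (fun s => secM l (exp (-s))) (Set.Ioi 0) := by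
  unfold secM
  refine ContinuousOn.div (by fun_prop) (by fun_prop) fun s hs => ?_
  exact mul_ne_zero (pow_ne_zero _ (sub_ne_zero.2 (exp_neg_lt_one hs).ne'))
    (one_add_mul_pos hl (exp_pos _) (exp_neg_lt_one hs)).ne'

lemma hasDerivAt_logZ {s : ℝ} (hs : 0 < s) :
    HasDerivAt (fun s => logZ l (exp (-s))) (-meanN l (exp (-s))) s := by
  have hq0 := exp_pos (-s)
  have hq1 := exp_neg_lt_one hs
  have h1q : 0 < 1 - exp (-s) := by linarith
  have he : HasDerivAt (fun s : ℝ => exp (-s)) (-exp (-s)) s := by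
    simpa using (hasDerivAt_neg s).exp
  have hz : (1 + l * exp (-s) / (1 - exp (-s))) ≠ 0 := by positivity
  have h := ((he.const_mul l).div (he.const_sub 1) h1q.ne').const_add 1 |>.log hz
  refine h.congr_deriv ?_
  have : 1 + l * exp (-s) / (1 - exp (-s)) = (1 + (l - 1) * exp (-s)) / (1 - exp (-s)) := by
    field_simp; ring
  simp only [Pi.div_apply]
  rw [this]
  unfold meanN
  field_simp
  ring

lemma continuousOn_logZ : ContinuousOn (fun s => logZ l (exp (-s))) (Set.Ioi 0) :=
  fun _ hs => (hasDerivAt_logZ hl hs).continuousAt.continuousWithinAt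

end Continuity

lemma integrableOn_of_exp_bound {u : ℝ → ℝ} {C : ℝ} (hu : ContinuousOn u (Set.Ioi 0))
    (h0 : ∀ s > 0, 0 ≤ u s) (hC : ∀ s > 0, u s ≤ C * exp (-s / 2)) :
    IntegrableOn u (Set.Ioi 0) := by
  have hdom : IntegrableOn (fun s : ℝ => C * exp (-s / 2)) (Set.Ioi 0) := by
    have := (integrableOn_exp_mul_Ioi (a := -(1/2)) (by norm_num) 0).const_mul C
    refine (integrableOn_congr_fun (fun s _ => ?_) measurableSet_Ioi).1 this
    congr 2; ring
  refine hdom.mono' (hu.aestronglyMeasurable measurableSet_Ioi) ?_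
  refine (ae_restrict_iff' measurableSet_Ioi).2 (Eventually.of_forall fun s hs => ?_)
  rw [Real.norm_eq_abs, abs_of_nonneg (h0 s hs)]
  exact hC s hs

open scoped ENNReal in
/-- Integration over the positive quadrant along the lines of constant coordinate sum. -/
lemma lintegral_quadrant {G : ℝ × ℝ → ℝ≥0∞} (hG : Measurable G) :
    ∫⁻ t : ℝ × ℝ in Set.Ioi (0:ℝ) ×ˢ Set.Ioi (0:ℝ), G (t.1, t.1 + t.2)
      = ∫⁻ s in Set.Ioi (0:ℝ), ∫⁻ t in Set.Ioo 0 s, G (t, s) := by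
  let T : Set (ℝ × ℝ) := {p | 0 < p.1 ∧ p.1 < p.2}
  have hT : MeasurableSet T :=
    (measurableSet_lt measurable_const measurable_fst).inter
      (measurableSet_lt measurable_fst measurable_snd)
  have hmp := measurePreserving_prod_add (volume : Measure ℝ) (volume : Measure ℝ)
  have h1 := hmp.lintegral_comp (hG.indicator hT)
  rw [← lintegral_indicator (measurableSet_Ioi.prod measurableSet_Ioi)]
  have h2 : ∀ t : ℝ × ℝ, (Set.Ioi (0:ℝ) ×ˢ Set.Ioi (0:ℝ)).indicator (fun t => G (t.1, t.1 + t.2)) t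
      = T.indicator G (t.1, t.1 + t.2) := by
    intro t
    have : t ∈ Set.Ioi (0:ℝ) ×ˢ Set.Ioi (0:ℝ) ↔ (t.1, t.1 + t.2) ∈ T := by
      simp [T]
    by_cases h : t ∈ Set.Ioi (0:ℝ) ×ˢ Set.Ioi (0:ℝ)
    · rw [Set.indicator_of_mem h, Set.indicator_of_mem (this.1 h)]
    · rw [Set.indicator_of_notMem h, Set.indicator_of_notMem (mt this.2 h)]
  simp only [h2]
  rw [Measure.volume_eq_prod, h1, lintegral_prod_symm' _ (hG.indicator hT),
    ← lintegral_indicator measurableSet_Ioi]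
  refine lintegral_congr fun s => ?_
  by_cases hs : 0 < s
  · rw [Set.indicator_of_mem (by exact hs), ← lintegral_indicator measurableSet_Ioo]
    refine lintegral_congr fun t => ?_
    by_cases h : t ∈ Set.Ioo 0 s
    · rw [Set.indicator_of_mem h, Set.indicator_of_mem (by exact h)]
    · rw [Set.indicator_of_notMem h, Set.indicator_of_notMem (by exact h)]
  · rw [Set.indicator_of_notMem (by exact hs)]
    rw [← lintegral_zero (μ := (volume : Measure ℝ))]
    refine lintegral_congr fun t => ?_
    rw [Set.indicator_of_notMem]
    intro h
    exact hs (h.1.trans h.2)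

lemma integral_quadrant {w k W : ℝ → ℝ} (hw : Measurable w) (hk : Measurable k)
    (hw0 : ∀ t > 0, 0 ≤ w t) (hk0 : ∀ s > 0, 0 ≤ k s)
    (hW : ∀ s > 0, ∫ t in Set.Ioo 0 s, w t = W s)
    (hwi : ∀ s > 0, IntegrableOn w (Set.Ioo 0 s)) (hWm : Measurable W) :
    ∫ t : ℝ × ℝ in Set.Ioi (0:ℝ) ×ˢ Set.Ioi (0:ℝ), w t.1 * k (t.1 + t.2)
      = ∫ s in Set.Ioi (0:ℝ), W s * k s := by
  have hQ := (measurableSet_Ioi (a := (0:ℝ))).prod (measurableSet_Ioi (a := (0:ℝ)))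
  have hW0 : ∀ s > 0, 0 ≤ W s := fun s hs => by
    rw [← hW s hs]
    exact setIntegral_nonneg measurableSet_Ioo fun t ht => hw0 t ht.1
  rw [integral_eq_lintegral_of_nonneg_ae, integral_eq_lintegral_of_nonneg_ae]
  · congr 1
    rw [lintegral_quadrant (G := fun p => ENNReal.ofReal (w p.1 * k p.2)) (by fun_prop)]
    refine setLIntegral_congr_fun measurableSet_Ioi fun s hs => ?_
    simp only
    rw [← hW s hs, ← integral_mul_const, ofReal_integral_eq_lintegral_ofReal
      ((hwi s hs).mul_const _)]
    exact (ae_restrict_iff' measurableSet_Ioo).2 (Eventually.of_forall fun t ht =>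
      mul_nonneg (hw0 t ht.1) (hk0 s hs))
  · exact (ae_restrict_iff' measurableSet_Ioi).2 (Eventually.of_forall fun s hs =>
      mul_nonneg (hW0 s hs) (hk0 s hs))
  · exact (hWm.mul hk).aestronglyMeasurable
  · refine (ae_restrict_iff' hQ).2 (Eventually.of_forall fun t ht => ?_)
    have h1 : 0 < t.1 := ht.1
    have h2 : 0 < t.2 := ht.2
    exact mul_nonneg (hw0 _ h1) (hk0 _ (by positivity))
  · exact Measurable.aestronglyMeasurable (by fun_prop)

section Integrals

variable {l : ℝ} (hl : 0 < l)
include hl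

lemma Bint_eq : Bint l = ∫ s in Set.Ioi (0:ℝ), s * occP l (exp (-s)) := by
  have h := integral_quadrant (w := fun _ => 1) (k := fun s => occP l (exp (-s)))
    (W := fun s => s) measurable_const (by unfold occP; fun_prop) (fun _ _ => zero_le_one)
    (fun s hs => (occP_pos hl (exp_pos _) (exp_neg_lt_one hs)).le)
    (fun s hs => by simp [Measure.real, hs.le])
    (fun s _ => by simp) measurable_id
  rw [← h]
  simp only [one_mul]
  rfl

lemma Aint_eq : Aint l = ∫ s in Set.Ioi (0:ℝ), s ^ 2 / 2 * meanN l (exp (-s)) := by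
  have h := integral_quadrant (w := fun t => t) (k := fun s => meanN l (exp (-s)))
    (W := fun s => s ^ 2 / 2) measurable_id (by unfold meanN; fun_prop) (fun _ h => le_of_lt h)
    (fun s hs => (meanN_pos hl (exp_pos _) (exp_neg_lt_one hs)).le)
    (fun s hs => by
      rw [← integral_Ioc_eq_integral_Ioo, ← intervalIntegral.integral_of_le (le_of_lt hs),
        integral_id]
      ring)
    (fun s _ => (continuous_id.integrableOn_Icc (a := 0) (b := s)).mono_set
      Set.Ioo_subset_Icc_self) (by fun_prop)
  rw [← h, Aint]
  refine integral_congr_ae (Eventually.of_forall fun t => ?_)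
  simp only [meanN]
  ring

lemma two_mul_Aint_eq : 2 * Aint l = ∫ s in Set.Ioi (0:ℝ), s ^ 2 * meanN l (exp (-s)) := by
  rw [Aint_eq hl, ← integral_const_mul]
  congr 1; ext s; ring

open Topology in
lemma Aint_eq_logZ : Aint l = ∫ s in Set.Ioi (0:ℝ), s * logZ l (exp (-s)) := by
  obtain ⟨C, hC⟩ := exists_weight_bounds hl
  have hiL : IntegrableOn (fun s => s * logZ l (exp (-s))) (Set.Ioi 0) :=
    integrableOn_of_exp_bound (continuousOn_id.mul (continuousOn_logZ hl))
    (fun s hs => mul_nonneg (le_of_lt hs) (logZ_nonneg hl (exp_pos _) (exp_neg_lt_one hs)))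
    (fun s hs => (hC s hs).2.2.1)
  have hiM := integrableOn_of_exp_bound ((continuousOn_pow 2).mul (continuousOn_meanN hl))
    (fun s hs => mul_nonneg (sq_nonneg s) (meanN_pos hl (exp_pos _) (exp_neg_lt_one hs)).le)
    (fun s hs => (hC s hs).2.1)
  have hiM2 : IntegrableOn (fun s => s ^ 2 / 2 * meanN l (exp (-s))) (Set.Ioi 0) := by
    refine (integrableOn_congr_fun (fun s _ => ?_) measurableSet_Ioi).1 (hiM.const_mul (1 / 2))
    simp only [Pi.mul_apply]
    ring
  have hbound : ∀ s > 0, |s ^ 2 / 2 * logZ l (exp (-s))| ≤ C / 2 * (s * exp (-s / 2)) := by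
    intro s hs
    have h0 := logZ_nonneg hl (exp_pos (-s)) (exp_neg_lt_one hs)
    rw [abs_of_nonneg (by positivity)]
    calc s ^ 2 / 2 * logZ l (exp (-s)) = s / 2 * (s * logZ l (exp (-s))) := by ring
      _ ≤ s / 2 * (C * exp (-s / 2)) := by
        have := (hC s hs).2.2.1
        gcongr
      _ = _ := by ring
  have hcont : ContinuousWithinAt (fun s => s ^ 2 / 2 * logZ l (exp (-s))) (Set.Ici 0) 0 := by
    have h1 : Tendsto (fun s : ℝ => C / 2 * (s * exp (-s / 2))) (𝓝[≥] 0) (𝓝 0) := by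
      have : Continuous fun s : ℝ => C / 2 * (s * exp (-s / 2)) := by fun_prop
      have h2 := this.tendsto 0
      simp only [zero_mul, mul_zero] at h2
      exact h2.mono_left nhdsWithin_le_nhds
    unfold ContinuousWithinAt
    simp only [ne_eq, OfNat.ofNat_ne_zero, not_false_eq_true, zero_pow, zero_div, zero_mul]
    refine squeeze_zero_norm' ?_ h1
    filter_upwards [self_mem_nhdsWithin] with s hs
    rcases eq_or_lt_of_le (show 0 ≤ s from hs) with rfl | hs
    · simp
    · exact hbound s hs
  have htop : Tendsto (fun s => s ^ 2 / 2 * logZ l (exp (-s))) atTop (𝓝 0) := by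
    have h1 : Tendsto (fun s : ℝ => C / 2 * (s * exp (-s / 2))) atTop (𝓝 0) := by
      have h2 := (tendsto_pow_mul_exp_neg_atTop_nhds_zero 1).comp
        (tendsto_id.atTop_div_const (two_pos : (0:ℝ) < 2))
      have h3 := h2.const_mul C
      rw [mul_zero] at h3
      refine h3.congr fun s => ?_
      simp only [Function.comp, id, pow_one, neg_div]
      ring
    refine squeeze_zero_norm' ?_ h1
    filter_upwards [eventually_gt_atTop 0] with s hs
    exact hbound s hs
  have h := integral_Ioi_of_hasDerivAt_of_tendsto
    (f' := fun s => s * logZ l (exp (-s)) - s ^ 2 / 2 * meanN l (exp (-s))) hcont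
    (fun s hs => ?_) (hiL.sub hiM2) htop
  · rw [integral_sub hiL hiM2] at h
    simp only [ne_eq, OfNat.ofNat_ne_zero, not_false_eq_true, zero_pow, zero_div, zero_mul,
      sub_zero] at h
    rw [Aint_eq hl]
    linarith
  · have h1 : HasDerivAt (fun s : ℝ => s ^ 2 / 2) s s := by
      have := (hasDerivAt_pow 2 s).div_const 2
      refine this.congr_deriv ?_
      simp
    refine (h1.mul (hasDerivAt_logZ hl hs)).congr_deriv ?_
    ring

end Integrals

section Site

lemma HasSum.of_eq {f g : ℕ → ℝ} {a c : ℝ} (h : HasSum f a) (hg : ∀ m, g m = f m) (hc : c = a) :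
    HasSum g c := by
  rw [hc, funext hg]; exact h

open ProbabilityTheory

/-- Weight of multiplicity `m` for a primitive vector of weight `q`. -/
noncomputable def siteW (l q : ℝ) (m : ℕ) : ℝ :=
  exp (-logZ l q) * ((if m = 0 then 1 else l) * q ^ m)

/-- Law of the multiplicity of a primitive vector of weight `q`. -/
noncomputable def siteMeasure (l q : ℝ) : Measure ℕ :=
  Measure.sum fun m => ENNReal.ofReal (siteW l q m) • Measure.dirac m

variable {l q : ℝ} (hl : 0 < l) (hq0 : 0 < q) (hq1 : q < 1)
include hl hq0

lemma siteW_nonneg (m : ℕ) : 0 ≤ siteW l q m := by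
  unfold siteW
  split_ifs <;> positivity

include hq1

lemma exp_neg_logZ : exp (-logZ l q) = (1 - q) / (1 + (l - 1) * q) := by
  have h1 := one_add_mul_pos hl hq0 hq1
  have h2 : 0 < 1 - q := by linarith
  have h3 : 1 + l * q / (1 - q) = (1 + (l - 1) * q) / (1 - q) := by field_simp; ring
  rw [logZ, h3, Real.exp_neg, Real.exp_log (by positivity), inv_div]

lemma hasSum_siteW : HasSum (siteW l q) 1 := by
  have h1 := one_add_mul_pos hl hq0 hq1
  have h2 : 0 < 1 - q := by linarith
  have h := ((hasSum_geometric_of_lt_one hq0.le hq1).mul_left l).add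
    (hasSum_ite_eq (0 : ℕ) (1 - l))
  have h3 := h.mul_left (exp (-logZ l q))
  rw [exp_neg_logZ hl hq0 hq1] at h3
  refine h3.of_eq (fun m => ?_) ?_
  · rw [siteW, exp_neg_logZ hl hq0 hq1]
    congr 1
    split_ifs with hm
    · subst hm; simp
    · simp
  · rw [div_mul_eq_mul_div, eq_comm, div_eq_one_iff_eq h1.ne']; field_simp; ring

lemma isProbabilityMeasure_site : IsProbabilityMeasure (siteMeasure l q) :=
  (hasSum_siteW hl hq0 hq1).isProbabilityMeasure_sum_dirac (siteW_nonneg hl hq0)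

omit hq1 in
lemma siteMeasure_real_singleton (m : ℕ) : (siteMeasure l q).real {m} = siteW l q m := by
  rw [measureReal_def, siteMeasure, Measure.sum_smul_dirac_singleton,
    ENNReal.toReal_ofReal (siteW_nonneg hl hq0 m)]

omit hq1 in
lemma hasSum_integral_site {f : ℕ → ℝ} (hf : Summable fun m => siteW l q m * |f m|) :
    HasSum (fun m => siteW l q m * f m) (∫ m, f m ∂siteMeasure l q) := by
  have := hasSum_integral_sum_dirac (f := f) (x := fun m : ℕ => m)
    (c := fun m => ENNReal.ofReal (siteW l q m)) (fun _ => ENNReal.ofReal_ne_top)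
  simp only [ENNReal.toReal_ofReal (siteW_nonneg hl hq0 _), Real.norm_eq_abs, smul_eq_mul] at this
  exact this hf

omit hq1 in
lemma integrable_site {f : ℕ → ℝ} (hf : Summable fun m => siteW l q m * |f m|) :
    Integrable f (siteMeasure l q) := by
  have := integrable_sum_dirac (f := f) (x := fun m : ℕ => m)
    (c := fun m => ENNReal.ofReal (siteW l q m)) (fun _ => ENNReal.ofReal_ne_top)
  simp only [ENNReal.toReal_ofReal (siteW_nonneg hl hq0 _), Real.norm_eq_abs] at this
  exact this hf

lemma hasSum_siteW_mul_self : HasSum (fun m : ℕ => siteW l q m * m) (meanN l q) := by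
  have h := (hasSum_coe_mul_geometric_of_norm_lt_one
    (show ‖q‖ < 1 by rwa [Real.norm_of_nonneg hq0.le])).mul_left (exp (-logZ l q) * l)
  refine h.of_eq (fun m => ?_) ?_
  · rw [siteW]
    split_ifs with hm
    · subst hm; simp
    · ring
  · rw [exp_neg_logZ hl hq0 hq1, meanN]; field_simp

lemma hasSum_siteW_mul_sq : HasSum (fun m : ℕ => siteW l q m * (m : ℝ) ^ 2) (secM l q) := by
  have h2 : 0 < 1 - q := by linarith
  have hq : ‖q‖ < 1 := by rwa [Real.norm_of_nonneg hq0.le]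
  have h := ((((hasSum_choose_mul_geometric_of_norm_lt_one 2 hq).mul_left 2).sub
    ((hasSum_coe_mul_geometric_of_norm_lt_one hq).mul_left 3)).sub
    ((hasSum_geometric_of_lt_one hq0.le hq1).mul_left 2)).mul_left (exp (-logZ l q) * l)
  refine h.of_eq (fun m => ?_) ?_
  · rw [siteW]
    have hc : (((m + 2).choose 2 : ℕ) : ℝ) = (m + 2) * (m + 1) / 2 := by
      rw [Nat.cast_choose_two]; push_cast; ring
    rw [hc]
    split_ifs with hm
    · subst hm; simp
    · ring
  · rw [exp_neg_logZ hl hq0 hq1, secM]; field_simp; ring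

lemma hasSum_siteW_occ :
    HasSum (fun m : ℕ => siteW l q m * (if m = 0 then 0 else 1)) (occP l q) := by
  have h1 := one_add_mul_pos hl hq0 hq1
  have h := (hasSum_siteW hl hq0 hq1).sub (hasSum_ite_eq (0 : ℕ) (siteW l q 0))
  refine h.of_eq (fun m => ?_) ?_
  · split_ifs with hm
    · subst hm; simp
    · simp
  · rw [siteW, exp_neg_logZ hl hq0 hq1, occP, if_pos rfl, pow_zero, mul_one, mul_one,
      eq_sub_iff_add_eq, ← add_div, div_eq_one_iff_eq h1.ne']
    ring

lemma integral_site_id : ∫ m : ℕ, (m : ℝ) ∂siteMeasure l q = meanN l q := by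
  have h := hasSum_siteW_mul_self hl hq0 hq1
  exact (hasSum_integral_site hl hq0 (by simpa using h.summable)).unique h

lemma integral_site_occ :
    ∫ m : ℕ, (if m = 0 then (0:ℝ) else 1) ∂siteMeasure l q = occP l q := by
  have h := hasSum_siteW_occ hl hq0 hq1
  refine (hasSum_integral_site hl hq0 ?_).unique h
  refine h.summable.congr fun m => ?_
  split_ifs <;> simp

lemma memLp_site {h : ℕ → ℝ} {c : ℝ} (hc : ∀ m : ℕ, |h m| ≤ c * m) :
    MemLp h 2 (siteMeasure l q) := by
  rw [memLp_two_iff_integrable_sq (measurable_of_countable h).aestronglyMeasurable]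
  refine integrable_site hl hq0 ?_
  refine Summable.of_nonneg_of_le
    (fun m => mul_nonneg (siteW_nonneg hl hq0 m) (abs_nonneg _)) (fun m => ?_)
    ((hasSum_siteW_mul_sq hl hq0 hq1).summable.mul_left (c ^ 2))
  have h3 : |h m ^ 2| ≤ c ^ 2 * (m : ℝ) ^ 2 := by
    rw [abs_pow, ← mul_pow]
    exact pow_le_pow_left₀ (abs_nonneg _) (hc m) 2
  calc siteW l q m * |h m ^ 2| ≤ siteW l q m * (c ^ 2 * (m : ℝ) ^ 2) :=
        mul_le_mul_of_nonneg_left h3 (siteW_nonneg hl hq0 m)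
    _ = _ := by ring

lemma variance_site_le {h : ℕ → ℝ} {c : ℝ} (hc : ∀ m : ℕ, |h m| ≤ c * m) :
    variance h (siteMeasure l q) ≤ c ^ 2 * secM l q := by
  have := isProbabilityMeasure_site hl hq0 hq1
  refine (variance_le_expectation_sq
    (measurable_of_countable h).aestronglyMeasurable).trans ?_
  have hint : Integrable (fun m => h m ^ 2) (siteMeasure l q) :=
    (memLp_site hl hq0 hq1 hc).integrable_sq
  have h2 := (hasSum_siteW_mul_sq hl hq0 hq1)
  have h2i : Integrable (fun m : ℕ => (m : ℝ) ^ 2) (siteMeasure l q) :=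
    integrable_site hl hq0 (by simpa using h2.summable)
  have h2e : ∫ m : ℕ, (m : ℝ) ^ 2 ∂siteMeasure l q = secM l q :=
    (hasSum_integral_site hl hq0 (by simpa using h2.summable)).unique h2
  rw [← h2e, ← integral_const_mul]
  refine integral_mono hint (h2i.const_mul _) fun m => ?_
  simp only [Pi.pow_apply]
  rw [← sq_abs, ← mul_pow]
  exact pow_le_pow_left₀ (abs_nonneg _) (hc m) 2

lemma variance_site_occ_le :
    variance (fun m : ℕ => if m = 0 then (0:ℝ) else 1) (siteMeasure l q) ≤ occP l q := by
  have := isProbabilityMeasure_site hl hq0 hq1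
  refine (variance_le_expectation_sq
    (measurable_of_countable _).aestronglyMeasurable).trans (le_of_eq ?_)
  rw [← integral_site_occ hl hq0 hq1]
  refine integral_congr_ae (ae_of_all _ fun m => ?_)
  simp

end Site

section Product

open ProbabilityTheory

variable {ι : Type*} [Fintype ι] {l : ℝ} (hl : 0 < l) {q : ι → ℝ} (hq0 : ∀ i, 0 < q i)
  (hq1 : ∀ i, q i < 1)
include hl hq0 hq1

lemma pi_site_real_singleton (ω : ι → ℕ) :
    (Measure.pi fun i => siteMeasure l (q i)).real {ω} = ∏ i, siteW l (q i) (ω i) := by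
  have := fun i => isProbabilityMeasure_site hl (hq0 i) (hq1 i)
  rw [measureReal_def, Measure.pi_singleton, ENNReal.toReal_prod]
  refine Finset.prod_congr rfl fun i _ => ?_
  exact siteMeasure_real_singleton hl (hq0 i) _

lemma pi_site_chebyshev {h : ι → ℕ → ℝ} {c v : ι → ℝ} (hc : ∀ i, ∀ m : ℕ, |h i m| ≤ c i * m)
    (hv : ∀ i, variance (h i) (siteMeasure l (q i)) ≤ v i) {t : ℝ} (ht : 0 < t) :
    (Measure.pi fun i => siteMeasure l (q i)).real
      {ω | t ≤ |∑ i, h i (ω i) - ∑ i, ∫ m, h i m ∂siteMeasure l (q i)|}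
      ≤ (∑ i, v i) / t ^ 2 := by
  have hP := fun i => isProbabilityMeasure_site hl (hq0 i) (hq1 i)
  have hL := fun i => memLp_site hl (hq0 i) (hq1 i) (hc i)
  have hLi : ∀ i, MemLp (fun ω : ι → ℕ => h i (ω i)) 2
      (Measure.pi fun i => siteMeasure l (q i)) := fun i =>
    (hL i).comp_measurePreserving (measurePreserving_eval _ i)
  have hS : MemLp (∑ i, fun ω : ι → ℕ => h i (ω i)) 2
      (Measure.pi fun i => siteMeasure l (q i)) := memLp_finsetSum' _ fun i _ => hLi i
  have hE : ∫ ω, (∑ i, fun ω : ι → ℕ => h i (ω i)) ω ∂(Measure.pi fun i => siteMeasure l (q i))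
      = ∑ i, ∫ m, h i m ∂siteMeasure l (q i) := by
    simp only [Finset.sum_apply]
    rw [integral_finsetSum _ fun i _ => (hLi i).integrable one_le_two]
    refine Finset.sum_congr rfl fun i _ => ?_
    exact integral_comp_eval (μ := fun i => siteMeasure l (q i))
      (measurable_of_countable (h i)).aestronglyMeasurable
  have hV : variance (∑ i, fun ω : ι → ℕ => h i (ω i)) (Measure.pi fun i => siteMeasure l (q i))
      ≤ ∑ i, v i := by
    rw [variance_sum_pi hL]
    exact Finset.sum_le_sum fun i _ => hv i
  have h1 := meas_ge_le_variance_div_sq hS ht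
  rw [hE] at h1
  simp only [Finset.sum_apply] at h1
  have h2 := ENNReal.toReal_mono ENNReal.ofReal_ne_top h1
  rw [ENNReal.toReal_ofReal (div_nonneg (variance_nonneg _ _) (sq_nonneg t))] at h2
  refine h2.trans ?_
  gcongr

end Product

section Window

open ProbabilityTheory

variable {ι : Type*} [Fintype ι]

/-- Number of nonzero entries, as a real number. -/
noncomputable def occCount (ω : ι → ℕ) : ℝ := ∑ i, if ω i = 0 then 0 else 1

lemma siteW_eq_exp {l b s : ℝ} (hl : 0 < l) (m : ℕ) :
    siteW l (exp (-(b * s))) m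
      = exp (-logZ l (exp (-(b * s))) + (if m = 0 then 0 else 1) * Real.log l - b * (s * m)) := by
  have h1 : exp (-(b * s)) ^ m = exp (-(b * (s * m))) := by
    rw [← Real.exp_nat_mul]; ring_nf
  rw [siteW, h1, sub_eq_add_neg, Real.exp_add, Real.exp_add, mul_assoc]
  split_ifs with h
  · simp
  · rw [one_mul, Real.exp_log hl]

lemma prod_siteW_eq_exp {l b : ℝ} {s : ι → ℝ} (hl : 0 < l) (ω : ι → ℕ) :
    ∏ i, siteW l (exp (-(b * s i))) (ω i)
      = exp (-(∑ i, logZ l (exp (-(b * s i)))) + occCount ω * Real.log l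
          - b * ∑ i, s i * ω i) := by
  simp only [siteW_eq_exp hl, ← Real.exp_sum, occCount]
  rw [Finset.sum_sub_distrib, Finset.sum_add_distrib, Finset.sum_neg_distrib, Finset.sum_mul,
    Finset.mul_sum]

variable {l b : ℝ} (hl : 0 < l) (hb : 0 < b) {x₁ x₂ : ι → ℝ}

/-- The vectors of multiplicities whose endpoint and number of vertices are close to the mean. -/
def window (l b : ℝ) (x₁ x₂ : ι → ℝ) (t₁ t₂ : ℝ) : Set (ι → ℕ) :=
  {ω | |∑ i, x₁ i * ω i - ∑ i, x₁ i * meanN l (exp (-(b * (x₁ i + x₂ i))))| < t₁ ∧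
    |∑ i, x₂ i * ω i - ∑ i, x₂ i * meanN l (exp (-(b * (x₁ i + x₂ i))))| < t₁ ∧
    |occCount ω - ∑ i, occP l (exp (-(b * (x₁ i + x₂ i))))| < t₂}

include hl hb

lemma card_mul_prod_le {s : ι → ℝ} (hs : ∀ i, 0 < s i) {W : Set (ι → ℕ)} (hW : W.Finite) {B : ℝ}
    (hB : ∀ ω ∈ W, occCount ω * Real.log l - b * ∑ i, s i * ω i ≤ B) :
    (Measure.pi fun i => siteMeasure l (exp (-(b * s i)))).real W
      ≤ W.ncard * exp (-(∑ i, logZ l (exp (-(b * s i)))) + B) := by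
  have hq1 : ∀ i, exp (-(b * s i)) < 1 := fun i => exp_neg_lt_one (mul_pos hb (hs i))
  have hP := fun i => isProbabilityMeasure_site hl (exp_pos (-(b * s i))) (hq1 i)
  have h1 : (Measure.pi fun i => siteMeasure l (exp (-(b * s i)))).real W
      = ∑ ω ∈ hW.toFinset, (Measure.pi fun i => siteMeasure l (exp (-(b * s i)))).real {ω} := by
    rw [sum_measureReal_singleton, hW.coe_toFinset]
  rw [h1, Set.ncard_eq_toFinset_card W hW, ← nsmul_eq_mul]
  refine Finset.sum_le_card_nsmul _ _ _ fun ω hω => ?_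
  rw [pi_site_real_singleton hl (fun i => exp_pos _) hq1, prod_siteW_eq_exp hl]
  have := hB ω (hW.mem_toFinset.1 hω)
  exact Real.exp_le_exp.2 (by linarith)

lemma card_mul_exp_le_one {s : ι → ℝ} (hs : ∀ i, 0 < s i) {W : Set (ι → ℕ)} (hW : W.Finite)
    {B : ℝ} (hB : ∀ ω ∈ W, occCount ω * Real.log l - b * ∑ i, s i * ω i = B) :
    W.ncard * exp (-(∑ i, logZ l (exp (-(b * s i)))) + B) ≤ 1 := by
  have hq1 : ∀ i, exp (-(b * s i)) < 1 := fun i => exp_neg_lt_one (mul_pos hb (hs i))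
  have hP := fun i => isProbabilityMeasure_site hl (exp_pos (-(b * s i))) (hq1 i)
  refine le_trans (le_of_eq ?_) (measureReal_le_one
    (μ := Measure.pi fun i => siteMeasure l (exp (-(b * s i)))) (s := W))
  rw [← hW.coe_toFinset, ← sum_measureReal_singleton, hW.coe_toFinset,
    Set.ncard_eq_toFinset_card W hW, ← nsmul_eq_mul]
  refine (Finset.sum_eq_card_nsmul fun ω hω => ?_).symm
  rw [pi_site_real_singleton hl (fun i => exp_pos _) hq1, prod_siteW_eq_exp hl,
    ← hB ω (hW.mem_toFinset.1 hω), add_sub_assoc]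

lemma window_ncard_ge (h₁ : ∀ i, 0 ≤ x₁ i) (h₂ : ∀ i, 0 ≤ x₂ i) (hs : ∀ i, 0 < x₁ i + x₂ i)
    {t₁ t₂ : ℝ} (ht₁ : 0 < t₁) (ht₂ : 0 < t₂)
    (hV₁ : ∑ i, (x₁ i + x₂ i) ^ 2 * secM l (exp (-(b * (x₁ i + x₂ i)))) ≤ t₁ ^ 2 / 6)
    (hV₂ : ∑ i, occP l (exp (-(b * (x₁ i + x₂ i)))) ≤ t₂ ^ 2 / 6)
    (hfin : (window l b x₁ x₂ t₁ t₂).Finite) :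
    exp (∑ i, logZ l (exp (-(b * (x₁ i + x₂ i))))
        + b * ∑ i, (x₁ i + x₂ i) * meanN l (exp (-(b * (x₁ i + x₂ i))))
        - (∑ i, occP l (exp (-(b * (x₁ i + x₂ i))))) * Real.log l
        - 2 * (b * t₁) - t₂ * |Real.log l|) / 2 ≤ (window l b x₁ x₂ t₁ t₂).ncard := by
  set q : ι → ℝ := fun i => exp (-(b * (x₁ i + x₂ i)))
  have hq0 : ∀ i, 0 < q i := fun i => exp_pos _
  have hq1 : ∀ i, q i < 1 := fun i => exp_neg_lt_one (mul_pos hb (hs i))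
  have hP := fun i => isProbabilityMeasure_site hl (hq0 i) (hq1 i)
  set P := Measure.pi fun i => siteMeasure l (q i)
  have hlin : ∀ y : ι → ℝ, (∀ i, 0 ≤ y i) → (∀ i, y i ≤ x₁ i + x₂ i) →
      P.real {ω | t₁ ≤ |∑ i, y i * ω i - ∑ i, y i * meanN l (q i)|} ≤ 1 / 6 := by
    intro y hy hy'
    have hc : ∀ i, ∀ m : ℕ, |y i * (m : ℝ)| ≤ y i * m := fun i m =>
      (abs_of_nonneg (mul_nonneg (hy i) m.cast_nonneg)).le
    have h := pi_site_chebyshev hl hq0 hq1 (h := fun i m => y i * (m : ℝ)) (c := y)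
      (v := fun i => (x₁ i + x₂ i) ^ 2 * secM l (q i)) hc (fun i => ?_) ht₁
    · simp only [integral_const_mul, integral_site_id hl (hq0 _) (hq1 _)] at h
      refine h.trans ?_
      rw [div_le_iff₀ (by positivity)]
      linarith
    · refine (variance_site_le hl (hq0 i) (hq1 i) (hc i)).trans ?_
      have := (secM_pos hl (hq0 i) (hq1 i)).le
      gcongr
      · exact hy i
      · exact hy' i
  have h1 := hlin x₁ h₁ (fun i => by linarith [h₂ i])
  have h2 := hlin x₂ h₂ (fun i => by linarith [h₁ i])
  have h3 : P.real {ω | t₂ ≤ |occCount ω - ∑ i, occP l (q i)|} ≤ 1 / 6 := by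
    have h := pi_site_chebyshev hl hq0 hq1 (h := fun _ m => if m = 0 then (0:ℝ) else 1)
      (c := fun _ => 1) (v := fun i => occP l (q i)) (fun i m => ?_)
      (fun i => variance_site_occ_le hl (hq0 i) (hq1 i)) ht₂
    · simp only [integral_site_occ hl (hq0 _) (hq1 _)] at h
      refine h.trans ?_
      rw [div_le_iff₀ (by positivity)]
      linarith
    · split_ifs with hm
      · simp
      · have : (1:ℝ) ≤ m := by exact_mod_cast Nat.one_le_iff_ne_zero.2 hm
        simpa using this
  have hW : 1 / 2 ≤ P.real (window l b x₁ x₂ t₁ t₂) := by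
    have hsub : (window l b x₁ x₂ t₁ t₂)ᶜ ⊆
        ({ω | t₁ ≤ |∑ i, x₁ i * ω i - ∑ i, x₁ i * meanN l (q i)|} ∪
        {ω | t₁ ≤ |∑ i, x₂ i * ω i - ∑ i, x₂ i * meanN l (q i)|}) ∪
        {ω | t₂ ≤ |occCount ω - ∑ i, occP l (q i)|} := by
      intro ω hω
      by_contra hcon
      simp only [Set.mem_union, Set.mem_ofPred_eq, not_or, not_le] at hcon
      exact hω ⟨hcon.1.1, hcon.1.2, hcon.2⟩
    have h4 := measureReal_mono hsub (μ := P)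
    have h5 := (h4.trans (measureReal_union_le _ _)).trans
      (add_le_add_left (measureReal_union_le _ _) _)
    have h6 : P.real (window l b x₁ x₂ t₁ t₂)ᶜ = 1 - P.real (window l b x₁ x₂ t₁ t₂) :=
      probReal_compl_eq_one_sub (Set.Countable.measurableSet hfin.countable)
    linarith
  have hcard := card_mul_prod_le hl hb hs hfin (B := (∑ i, occP l (q i)) * Real.log l
    + t₂ * |Real.log l| - b * ∑ i, (x₁ i + x₂ i) * meanN l (q i) + 2 * (b * t₁)) (fun ω hω => ?_)
  · have h7 := hW.trans hcard
    rw [div_le_iff₀ two_pos]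
    set E := ∑ i, logZ l (q i) + b * ∑ i, (x₁ i + x₂ i) * meanN l (q i)
        - (∑ i, occP l (q i)) * Real.log l - 2 * (b * t₁) - t₂ * |Real.log l| with hE
    have h8 : exp (-(∑ i, logZ l (q i)) + ((∑ i, occP l (q i)) * Real.log l
      + t₂ * |Real.log l| - b * ∑ i, (x₁ i + x₂ i) * meanN l (q i) + 2 * (b * t₁))) = exp (-E) := by
      rw [hE]; ring_nf
    have h9 : exp E * exp (-E) = 1 := by rw [← Real.exp_add]; simp
    change 1 / 2 ≤ _ * exp (-(∑ i, logZ l (q i)) + _) at h7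
    rw [h8] at h7
    nlinarith [exp_pos E, exp_pos (-E)]
  · obtain ⟨w1, w2, w3⟩ := hω
    have e1 : ∑ i, (x₁ i + x₂ i) * (ω i : ℝ) = ∑ i, x₁ i * ω i + ∑ i, x₂ i * ω i := by
      rw [← Finset.sum_add_distrib]; simp only [add_mul]
    have e2 : ∑ i, (x₁ i + x₂ i) * meanN l (q i)
        = ∑ i, x₁ i * meanN l (q i) + ∑ i, x₂ i * meanN l (q i) := by
      rw [← Finset.sum_add_distrib]; simp only [add_mul]
    have e3 : (occCount ω - ∑ i, occP l (q i)) * Real.log l ≤ t₂ * |Real.log l| := by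
      refine (le_abs_self _).trans ?_
      rw [abs_mul]
      exact mul_le_mul_of_nonneg_right w3.le (abs_nonneg _)
    rw [e1, e2]
    have w1' := (abs_lt.1 w1).1
    have w2' := (abs_lt.1 w2).1
    have e4 : b * (∑ i, x₁ i * meanN l (q i) + ∑ i, x₂ i * meanN l (q i) - 2 * t₁)
        ≤ b * (∑ i, x₁ i * ω i + ∑ i, x₂ i * ω i) := by
      apply mul_le_mul_of_nonneg_left _ hb.le
      change -t₁ < ∑ i, x₁ i * (ω i : ℝ) - ∑ i, x₁ i * meanN l (q i) at w1'
      change -t₁ < ∑ i, x₂ i * (ω i : ℝ) - ∑ i, x₂ i * meanN l (q i) at w2'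
      linarith
    linarith

end Window

section Chains

/-- Primitive vectors of size at most `K`. -/
noncomputable def Xc.ball (K : ℕ) : Finset Xc :=
  (((Set.finite_Iic ((K, K) : ℕ × ℕ)).preimage Subtype.val_injective.injOn).subset
    (show {x : Xc | x.size ≤ K} ⊆ Subtype.val ⁻¹' Set.Iic ((K, K) : ℕ × ℕ) from fun x hx => by
      have hx' : x.1.1 + x.1.2 ≤ K := hx
      refine ⟨?_, ?_⟩
      · change x.1.1 ≤ K; omega
      · change x.1.2 ≤ K; omega)).toFinset

lemma Xc.mem_ball {K : ℕ} {x : Xc} : x ∈ Xc.ball K ↔ x.size ≤ K := by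
  simp [Xc.ball]

lemma chainEndpoint_add (μ ν : Xc →₀ ℕ) :
    chainEndpoint (μ + ν) = chainEndpoint μ + chainEndpoint ν := by
  refine Prod.ext ?_ ?_
  · exact Finsupp.sum_add_index' (h := fun (x : Xc) (m : ℕ) => m * x.1.1) (fun _ => zero_mul _)
      fun x m m' => add_mul m m' _
  · exact Finsupp.sum_add_index' (h := fun (x : Xc) (m : ℕ) => m * x.1.2) (fun _ => zero_mul _)
      fun x m m' => add_mul m m' _

lemma chainEndpoint_eq_sum {ν : Xc →₀ ℕ} {F : Finset Xc} (h : ν.support ⊆ F) :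
    chainEndpoint ν = (∑ x ∈ F, ν x * x.1.1, ∑ x ∈ F, ν x * x.1.2) := by
  refine Prod.ext ?_ ?_
  · exact Finsupp.sum_of_support_subset _ h (fun x m => m * x.1.1) fun _ _ => zero_mul _
  · exact Finsupp.sum_of_support_subset _ h (fun x m => m * x.1.2) fun _ _ => zero_mul _

lemma chainEndpoint_size {ν : Xc →₀ ℕ} {n₁ n₂ : ℕ} (h : chainEndpoint ν = (n₁, n₂)) (x : Xc) :
    ν x * x.size ≤ n₁ + n₂ := by
  by_cases hx : x ∈ ν.support
  · have h1 : ν x * x.1.1 ≤ n₁ := by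
      refine le_of_le_of_eq ?_ (congrArg Prod.fst h)
      exact Finset.single_le_sum (f := fun x => ν x * x.1.1) (fun _ _ => Nat.zero_le _) hx
    have h2 : ν x * x.1.2 ≤ n₂ := by
      refine le_of_le_of_eq ?_ (congrArg Prod.snd h)
      exact Finset.single_le_sum (f := fun x => ν x * x.1.2) (fun _ _ => Nat.zero_le _) hx
    rw [Xc.size, mul_add]
    exact add_le_add h1 h2
  · simp [Finsupp.notMem_support_iff.1 hx]

lemma chainEndpoint_support {ν : Xc →₀ ℕ} {n₁ n₂ : ℕ} (h : chainEndpoint ν = (n₁, n₂)) :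
    ν.support ⊆ Xc.ball (n₁ + n₂) := fun x hx => by
  rw [Xc.mem_ball]
  have h1 := chainEndpoint_size h x
  have h2 : 1 ≤ ν x := Nat.one_le_iff_ne_zero.2 (Finsupp.mem_support_iff.1 hx)
  nlinarith

lemma finite_chains (n₁ n₂ : ℕ) : {ν : Xc →₀ ℕ | chainEndpoint ν = (n₁, n₂)}.Finite := by
  classical
  refine (Set.finite_Iic (Finsupp.indicator (Xc.ball (n₁ + n₂)) fun _ _ => n₁ + n₂)).subset ?_
  intro ν hν x
  by_cases hx : x ∈ ν.support
  · rw [Finsupp.indicator_of_mem (chainEndpoint_support hν hx)]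
    have h1 := chainEndpoint_size hν x
    have := x.size_pos
    nlinarith
  · simp [Finsupp.notMem_support_iff.1 hx]

lemma chains_ncard (n₁ n₂ N : ℕ) :
    {ν : Xc →₀ ℕ | chainEndpoint ν = (n₁, n₂) ∧ ν.support.card = N}.ncard = numChains n₁ n₂ N :=
  rfl

lemma occCount_eq_card {F : Finset Xc} {ν : Xc →₀ ℕ} (h : ν.support ⊆ F) :
    occCount (fun i : F => ν i) = ν.support.card := by
  classical
  rw [occCount, Finset.sum_coe_sort F (fun x => if ν x = 0 then (0:ℝ) else 1),
    Finset.card_eq_sum_ones, Nat.cast_sum, ← Finset.sum_subset h]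
  · refine Finset.sum_congr rfl fun x hx => ?_
    rw [if_neg (Finsupp.mem_support_iff.1 hx), Nat.cast_one]
  · intro x _ hx
    rw [if_pos (Finsupp.notMem_support_iff.1 hx)]

/-- Chernoff-type bound on the number of chains. -/
lemma numChains_le {l b : ℝ} (hl : 0 < l) (hb : 0 < b) (n N : ℕ) :
    (numChains n n N : ℝ) ≤ exp (∑ x ∈ Xc.ball (n + n), logZ l (exp (-(b * x.size)))
      + 2 * (b * n) - N * Real.log l) := by
  set F := Xc.ball (n + n)
  set S := {ν : Xc →₀ ℕ | chainEndpoint ν = (n, n) ∧ ν.support.card = N} with hS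
  have hSfin : S.Finite := (finite_chains n n).subset fun ν hν => hν.1
  let r : (Xc →₀ ℕ) → F → ℕ := fun ν i => ν i
  have hinj : Set.InjOn r S := by
    intro μ hμ ν hν h
    ext x
    by_cases hx : x ∈ F
    · exact congrFun h ⟨x, hx⟩
    · rw [Finsupp.notMem_support_iff.1 fun h => hx (chainEndpoint_support hμ.1 h),
        Finsupp.notMem_support_iff.1 fun h => hx (chainEndpoint_support hν.1 h)]
  have h := card_mul_exp_le_one hl hb (s := fun i : F => (i.1.size : ℝ))
    (fun i => by exact_mod_cast i.1.size_pos) (hSfin.image r)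
    (B := N * Real.log l - b * (n + n)) ?_
  · rw [hinj.ncard_image, hS, chains_ncard,
      Finset.sum_coe_sort F (fun x => logZ l (exp (-(b * x.size))))] at h
    set Y := ∑ x ∈ F, logZ l (exp (-(b * x.size)))
    have e : Y + 2 * (b * n) - N * Real.log l = -(-Y + (N * Real.log l - b * (n + n))) := by ring
    rw [e, Real.exp_neg, ← one_div, le_div_iff₀ (exp_pos _)]
    exact h
  · rintro _ ⟨ν, hν, rfl⟩
    have hsup := chainEndpoint_support hν.1
    rw [occCount_eq_card hsup, hν.2,
      Finset.sum_coe_sort F (fun x => (x.size : ℝ) * (ν x : ℝ))]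
    have h1 := hν.1
    rw [chainEndpoint_eq_sum hsup, Prod.mk.injEq] at h1
    have h2 : ∑ x ∈ F, (x.size : ℝ) * (ν x : ℝ) = n + n := by
      have : ∑ x ∈ F, x.size * ν x = n + n := by
        calc ∑ x ∈ F, x.size * ν x = ∑ x ∈ F, ν x * x.1.1 + ∑ x ∈ F, ν x * x.1.2 := by
              rw [← Finset.sum_add_distrib]
              exact Finset.sum_congr rfl fun x _ => by rw [Xc.size, mul_comm, mul_add]
          _ = n + n := by rw [h1.1, h1.2]
      exact_mod_cast this
    rw [h2]

lemma exists_fill {K k a₁ a₂ : ℕ} (hK : 1 ≤ K) (hk : 2 ≤ k) (hkb : k ≤ (Xc.ball K).card)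
    (h₁ : k * K < a₁) (h₂ : k * K < a₂) :
    ∃ ρ : Xc →₀ ℕ, ρ.support ⊆ Xc.ball K ∧ ρ.support.card = k ∧ chainEndpoint ρ = (a₁, a₂) := by
  classical
  let e₁ : Xc := ⟨(1, 0), by simp⟩
  let e₂ : Xc := ⟨(0, 1), by simp⟩
  have hne : e₁ ≠ e₂ := by simp [e₁, e₂]
  have he₁ : e₁ ∈ Xc.ball K := by rw [Xc.mem_ball]; simpa [Xc.size, e₁] using hK
  have he₂ : e₂ ∈ Xc.ball K := by rw [Xc.mem_ball]; simpa [Xc.size, e₂] using hK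
  have hsub : ({e₁, e₂} : Finset Xc) ⊆ Xc.ball K := by
    intro x hx
    rcases Finset.mem_insert.1 hx with rfl | hx
    · exact he₁
    · rw [Finset.mem_singleton.1 hx]; exact he₂
  obtain ⟨T, hT, hTc⟩ := Finset.exists_subset_card_eq
    (s := Xc.ball K \ {e₁, e₂}) (n := k - 2) (by
      rw [Finset.card_sdiff_of_subset hsub, Finset.card_pair hne]; omega)
  set τ : Xc →₀ ℕ := Finsupp.indicator T fun _ _ => 1 with hτ
  have hτv : ∀ x ∈ T, τ x = 1 := fun x hx => by rw [hτ, Finsupp.indicator_of_mem hx]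
  have hτs : τ.support = T := by
    ext x
    rw [Finsupp.mem_support_iff]
    by_cases hx : x ∈ T
    · simp [hτv x hx, hx]
    · simp [hτ, Finsupp.indicator_of_notMem hx, hx]
  have hτe := chainEndpoint_eq_sum (ν := τ) (F := T) hτs.le
  have hsz : ∀ x ∈ T, x.1.1 + x.1.2 ≤ K := fun x hx =>
    Xc.mem_ball.1 (Finset.mem_sdiff.1 (hT hx)).1
  set s₁ := ∑ x ∈ T, τ x * x.1.1
  set s₂ := ∑ x ∈ T, τ x * x.1.2
  have hb₁ : s₁ ≤ k * K := by
    calc s₁ ≤ T.card • K := Finset.sum_le_card_nsmul _ _ _ fun x hx => by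
          rw [hτv x hx]; have := hsz x hx; omega
      _ ≤ k * K := by rw [hTc, smul_eq_mul]; exact Nat.mul_le_mul_right _ (by omega)
  have hb₂ : s₂ ≤ k * K := by
    calc s₂ ≤ T.card • K := Finset.sum_le_card_nsmul _ _ _ fun x hx => by
          rw [hτv x hx]; have := hsz x hx; omega
      _ ≤ k * K := by rw [hTc, smul_eq_mul]; exact Nat.mul_le_mul_right _ (by omega)
  have hn₁ : e₁ ∉ T := fun h => by simpa using hT h
  have hn₂ : e₂ ∉ T := fun h => by simpa using hT h
  have hsup : (τ + (Finsupp.single e₁ (a₁ - s₁) + Finsupp.single e₂ (a₂ - s₂))).support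
      = T ∪ {e₁, e₂} := by
    have f₁ : (Finsupp.single e₁ (a₁ - s₁)).support = {e₁} :=
      Finsupp.support_single _ (by omega)
    have f₂ : (Finsupp.single e₂ (a₂ - s₂)).support = {e₂} :=
      Finsupp.support_single _ (by omega)
    have f₃ : (Finsupp.single e₁ (a₁ - s₁) + Finsupp.single e₂ (a₂ - s₂)).support = {e₁, e₂} := by
      rw [Finsupp.support_add_eq, f₁, f₂]
      · rfl
      · rw [f₁, f₂]; simpa using hne
    rw [Finsupp.support_add_eq, f₃, hτs]
    rw [f₃, hτs]
    simp [hn₁, hn₂]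
  refine ⟨τ + (Finsupp.single e₁ (a₁ - s₁) + Finsupp.single e₂ (a₂ - s₂)), ?_, ?_, ?_⟩
  · rw [hsup]
    exact Finset.union_subset (hT.trans Finset.sdiff_subset) hsub
  · rw [hsup, Finset.card_union_of_disjoint, Finset.card_pair hne, hTc]
    · omega
    · simp [hn₁, hn₂]
  · rw [chainEndpoint_add, chainEndpoint_add, hτe]
    simp only [chainEndpoint, Finsupp.sum_single_index, zero_mul, e₁, e₂, Prod.mk_add_mk,
      Prod.mk.injEq]
    omega

/-- Extension of a multiplicity vector by zero. -/
noncomputable def extendZero (F : Finset Xc) (ω : F → ℕ) : Xc →₀ ℕ := by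
  classical
  exact Finsupp.onFinset F (fun x => if h : x ∈ F then ω ⟨x, h⟩ else 0) fun x hx => by
    by_contra h
    simp [h] at hx

lemma extendZero_apply {F : Finset Xc} (ω : F → ℕ) (i : F) : extendZero F ω i = ω i := by
  simp [extendZero]

lemma extendZero_support {F : Finset Xc} (ω : F → ℕ) : (extendZero F ω).support ⊆ F :=
  Finsupp.support_onFinset_subset

/-- Partial configurations that can be completed inside a disjoint set of vectors inject into the
set of chains. -/
lemma ncard_le_numChains {F R : Finset Xc} (hFR : Disjoint F R) {n N : ℕ} {W : Set (F → ℕ)}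
    (hW : ∀ ω ∈ W, ∃ ρ : Xc →₀ ℕ, ρ.support ⊆ R ∧
      ρ.support.card + (extendZero F ω).support.card = N ∧
      chainEndpoint ρ + chainEndpoint (extendZero F ω) = (n, n)) :
    W.Finite ∧ W.ncard ≤ numChains n n N := by
  classical
  set S := {ν : Xc →₀ ℕ | chainEndpoint ν = (n, n) ∧ ν.support.card = N}
  have hSfin : S.Finite := (finite_chains n n).subset fun ν hν => hν.1
  let f : (F → ℕ) → Xc →₀ ℕ := fun ω =>
    if h : ω ∈ W then (hW ω h).choose + extendZero F ω else 0
  have hf : ∀ ω (h : ω ∈ W), f ω = (hW ω h).choose + extendZero F ω := fun ω h => dif_pos h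
  have hmaps : ∀ ω ∈ W, f ω ∈ S := by
    intro ω h
    obtain ⟨h1, h2, h3⟩ := (hW ω h).choose_spec
    rw [hf ω h]
    refine ⟨by rw [chainEndpoint_add, h3], ?_⟩
    rw [Finsupp.support_add_eq, Finset.card_union_of_disjoint, h2]
    all_goals exact (hFR.symm.mono_left h1).mono_right (extendZero_support ω)
  have hres : ∀ ω ∈ W, ∀ i : F, f ω i = ω i := by
    intro ω h i
    obtain ⟨h1, -, -⟩ := (hW ω h).choose_spec
    have : (hW ω h).choose i = 0 := Finsupp.notMem_support_iff.1 fun hi =>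
      Finset.disjoint_left.1 hFR i.2 (h1 hi)
    rw [hf ω h, Finsupp.add_apply, this, zero_add, extendZero_apply]
  have hinj : Set.InjOn f W := fun ω h ω' h' he => by
    funext i
    rw [← hres ω h, ← hres ω' h', he]
  refine ⟨Set.Finite.of_injOn hmaps hinj hSfin, ?_⟩
  rw [← chains_ncard]
  exact Set.ncard_le_ncard_of_injOn f hmaps hinj hSfin

end Chains

/-- Weight of a primitive vector at inverse temperature `b`. -/
noncomputable def Xc.q (b : ℝ) (x : Xc) : ℝ := exp (-(b * x.size))

/-- Lower bound for the number of chains by completing typical configurations outside a ball. -/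
lemma le_numChains {l b t₁ t₂ : ℝ} (hl : 0 < l) (hb : 0 < b) {F : Finset Xc} {K n N : ℕ}
    (hd : Disjoint F (Xc.ball K)) (hK : 1 ≤ K) (ht₁ : 0 < t₁) (ht₂ : 0 < t₂)
    (hV₁ : ∑ x ∈ F, (x.size : ℝ) ^ 2 * secM l (x.q b) ≤ t₁ ^ 2 / 6)
    (hV₂ : ∑ x ∈ F, occP l (x.q b) ≤ t₂ ^ 2 / 6)
    (hN : ∑ x ∈ F, occP l (x.q b) + t₂ + 2 ≤ N)
    (hN' : N ≤ ∑ x ∈ F, occP l (x.q b) - t₂ + (Xc.ball K).card)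
    (hn₁ : (N - ∑ x ∈ F, occP l (x.q b) + t₂) * K
      ≤ n - ∑ x ∈ F, (x.1.1 : ℝ) * meanN l (x.q b) - t₁)
    (hn₂ : (N - ∑ x ∈ F, occP l (x.q b) + t₂) * K
      ≤ n - ∑ x ∈ F, (x.1.2 : ℝ) * meanN l (x.q b) - t₁) :
    exp (∑ x ∈ F, logZ l (x.q b) + b * ∑ x ∈ F, (x.size : ℝ) * meanN l (x.q b)
        - (∑ x ∈ F, occP l (x.q b)) * Real.log l - 2 * (b * t₁) - t₂ * |Real.log l|) / 2
      ≤ numChains n n N := by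
  have hsz : ∀ x : Xc, (x.size : ℝ) = (x.1.1 : ℝ) + x.1.2 := fun x => by
    rw [Xc.size, Nat.cast_add]
  have key := ncard_le_numChains (n := n) (N := N) hd
    (W := window l b (fun i : F => (i.1.1.1 : ℝ)) (fun i : F => (i.1.1.2 : ℝ)) t₁ t₂)
    fun ω hω => ?_
  · have hpos : ∀ i : F, (0:ℝ) < (i.1.1.1 : ℝ) + i.1.1.2 := fun i => by
      rw [← hsz]; exact_mod_cast i.1.size_pos
    have h := window_ncard_ge hl hb (x₁ := fun i : F => (i.1.1.1 : ℝ))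
      (x₂ := fun i : F => (i.1.1.2 : ℝ)) (fun _ => Nat.cast_nonneg _) (fun _ => Nat.cast_nonneg _)
      hpos ht₁ ht₂ ?_ ?_ key.1
    · simp only [← hsz] at h
      rw [Finset.sum_coe_sort F fun x => logZ l (exp (-(b * (x.size : ℝ)))),
        Finset.sum_coe_sort F fun x => occP l (exp (-(b * (x.size : ℝ)))),
        Finset.sum_coe_sort F fun x => (x.size : ℝ) * meanN l (exp (-(b * (x.size : ℝ))))] at h
      exact h.trans (by exact_mod_cast key.2)
    · simp only [← hsz]
      rw [Finset.sum_coe_sort F fun x => (x.size : ℝ) ^ 2 * secM l (exp (-(b * (x.size : ℝ))))]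
      exact hV₁
    · simp only [← hsz]
      rw [Finset.sum_coe_sort F fun x => occP l (exp (-(b * (x.size : ℝ))))]
      exact hV₂
  · obtain ⟨w1, w2, w3⟩ := hω
    simp only [← hsz] at w1 w2 w3
    rw [Finset.sum_coe_sort F fun x => (x.1.1 : ℝ) * meanN l (exp (-(b * (x.size : ℝ))))] at w1
    rw [Finset.sum_coe_sort F fun x => (x.1.2 : ℝ) * meanN l (exp (-(b * (x.size : ℝ))))] at w2
    rw [Finset.sum_coe_sort F fun x => occP l (exp (-(b * (x.size : ℝ))))] at w3
    have hsup := extendZero_support ω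
    have hocc := occCount_eq_card hsup
    have hend := chainEndpoint_eq_sum hsup
    simp only [extendZero_apply] at hocc
    have e1 : ∑ i : F, (i.1.1.1 : ℝ) * ω i
        = ((∑ x ∈ F, extendZero F ω x * x.1.1 : ℕ) : ℝ) := by
      rw [← Finset.sum_coe_sort F]; push_cast
      exact Finset.sum_congr rfl fun i _ => by rw [extendZero_apply, mul_comm]
    have e2 : ∑ i : F, (i.1.1.2 : ℝ) * ω i
        = ((∑ x ∈ F, extendZero F ω x * x.1.2 : ℕ) : ℝ) := by
      rw [← Finset.sum_coe_sort F]; push_cast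
      exact Finset.sum_congr rfl fun i _ => by rw [extendZero_apply, mul_comm]
    set m₁ := ∑ x ∈ F, extendZero F ω x * x.1.1
    set m₂ := ∑ x ∈ F, extendZero F ω x * x.1.2
    set M := (extendZero F ω).support.card
    rw [e1] at w1
    rw [e2] at w2
    rw [hocc] at w3
    change |(M : ℝ) - ∑ x ∈ F, occP l (x.q b)| < t₂ at w3
    change |(m₁ : ℝ) - ∑ x ∈ F, (x.1.1 : ℝ) * meanN l (x.q b)| < t₁ at w1
    change |(m₂ : ℝ) - ∑ x ∈ F, (x.1.2 : ℝ) * meanN l (x.q b)| < t₁ at w2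
    rw [abs_lt] at w1 w2 w3
    have hMN : M + 2 ≤ N := by
      have : (M : ℝ) + 2 ≤ N := by linarith
      exact_mod_cast this
    have hkc : N - M ≤ (Xc.ball K).card := by
      have : (N : ℝ) ≤ (Xc.ball K).card + M := by linarith
      have : N ≤ (Xc.ball K).card + M := by exact_mod_cast this
      omega
    have hkr : ((N - M : ℕ) : ℝ) ≤ N - ∑ x ∈ F, occP l (x.q b) + t₂ := by
      rw [Nat.cast_sub (by omega)]; linarith
    have hkK : ((N - M : ℕ) : ℝ) * K ≤ (N - ∑ x ∈ F, occP l (x.q b) + t₂) * K :=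
      mul_le_mul_of_nonneg_right hkr (Nat.cast_nonneg _)
    have h1 : (N - M) * K + m₁ < n := by
      have : ((N - M : ℕ) : ℝ) * K + m₁ < n := by linarith
      exact_mod_cast this
    have h2 : (N - M) * K + m₂ < n := by
      have : ((N - M : ℕ) : ℝ) * K + m₂ < n := by linarith
      exact_mod_cast this
    obtain ⟨ρ, hρ, hρc, hρe⟩ := exists_fill (K := K) (k := N - M) (a₁ := n - m₁) (a₂ := n - m₂)
      hK (by omega) hkc (by omega) (by omega)
    refine ⟨ρ, hρ, by omega, ?_⟩
    rw [hρe, hend, Prod.mk_add_mk, Prod.mk.injEq]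
    omega

section Sums

open Topology

lemma Xc.tendsto_sum_mul {g : ℝ → ℝ} {C : ℝ} (hg : ContinuousOn (fun s => s * g s) (Set.Ioi 0))
    (h0 : ∀ s > 0, 0 ≤ s * g s) (hC : ∀ s > 0, s * g s ≤ C * exp (-s / 2)) :
    (∀ b > 0, Summable fun x : Xc => g (b * x.size)) ∧
    Tendsto (fun b : ℝ => b ^ 2 * ∑' x : Xc, g (b * x.size)) (𝓝[>] 0)
      (𝓝 ((∫ s in Set.Ioi (0:ℝ), s * g s) / zeta2)) := by
  have h := Xc.tendsto_sum hg h0 hC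
  have he : ∀ b > 0, ∀ x : Xc,
      b * x.size * g (b * x.size) / (b * x.size) = g (b * x.size) := fun b hb x => by
    have : 0 < b * (x.size : ℝ) := mul_pos hb (by exact_mod_cast x.size_pos)
    exact mul_div_cancel_left₀ _ this.ne'
  refine ⟨fun b hb => (h.1 b hb).congr (he b hb), h.2.congr' ?_⟩
  filter_upwards [self_mem_nhdsWithin] with b hb
  rw [tsum_congr (he b hb)]

lemma Xc.sum_ball_one_div (K : ℕ) : ∑ x ∈ Xc.ball K, 1 / (x.size : ℝ) ≤ 2 * K := by
  classical
  have hmaps : ∀ x ∈ Xc.ball K, x.size ∈ Finset.Icc 1 K := fun x hx =>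
    Finset.mem_Icc.2 ⟨x.size_pos, Xc.mem_ball.1 hx⟩
  rw [← Finset.sum_fiberwise_of_maps_to hmaps]
  calc ∑ m ∈ Finset.Icc 1 K, ∑ x ∈ Xc.ball K with x.size = m, 1 / (x.size : ℝ)
      ≤ ∑ m ∈ Finset.Icc 1 K, (2:ℝ) := by
        refine Finset.sum_le_sum fun m hm => ?_
        have hm1 : (0:ℝ) < m := by exact_mod_cast (Finset.mem_Icc.1 hm).1
        have hcard : ((Xc.ball K).filter fun x => x.size = m).card ≤ 2 * m := by
          refine le_trans ?_ (Xc.card_sizeFiber_le m)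
          rw [← Nat.card_eq_finsetCard]
          exact Nat.card_le_card_of_injective
            (fun x => ⟨x.1, (Finset.mem_filter.1 x.2).2⟩ :
              (Xc.ball K).filter (fun x => x.size = m) → {x : Xc // x.size = m})
            fun x y h => Subtype.ext (congrArg (fun z => z.1) h)
        calc ∑ x ∈ Xc.ball K with x.size = m, 1 / (x.size : ℝ)
            = ∑ x ∈ Xc.ball K with x.size = m, 1 / (m : ℝ) :=
              Finset.sum_congr rfl fun x hx => by rw [(Finset.mem_filter.1 hx).2]
          _ = (((Xc.ball K).filter fun x => x.size = m).card : ℝ) * (1 / m) := by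
              rw [Finset.sum_const, nsmul_eq_mul]
          _ ≤ (2 * m) * (1 / m) := by
              gcongr; exact_mod_cast hcard
          _ = 2 := by field_simp
    _ = 2 * K := by simp [mul_comm]

lemma Xc.sum_ball_le {g : ℝ → ℝ} {C b : ℝ} (hC0 : 0 ≤ C) (hb : 0 < b)
    (hC : ∀ s > 0, s * g s ≤ C * exp (-s / 2)) (K : ℕ) :
    ∑ x ∈ Xc.ball K, g (b * x.size) ≤ 2 * C * K / b := by
  calc ∑ x ∈ Xc.ball K, g (b * x.size) ≤ ∑ x ∈ Xc.ball K, C / b * (1 / x.size) := by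
        refine Finset.sum_le_sum fun x _ => ?_
        have hx : (0:ℝ) < x.size := by exact_mod_cast x.size_pos
        have h1 := hC (b * x.size) (mul_pos hb hx)
        have h2 : exp (-(b * x.size) / 2) ≤ 1 := Real.exp_le_one_iff.2 (by
          have := mul_pos hb hx
          linarith)
        have h3 : b * x.size * g (b * x.size) ≤ C := h1.trans (by nlinarith)
        rw [div_mul_div_comm, mul_one, le_div_iff₀ (mul_pos hb hx), mul_comm]
        exact h3
    _ ≤ C / b * (2 * K) := by
        rw [← Finset.mul_sum]
        exact mul_le_mul_of_nonneg_left (Xc.sum_ball_one_div K) (by positivity)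
    _ = _ := by ring

/-- Exchange of coordinates on primitive vectors. -/
def Xc.swap : Xc ≃ Xc :=
  (Equiv.prodComm ℕ ℕ).subtypeEquiv fun x => by
    simp only [Equiv.prodComm_apply, Prod.fst_swap, Prod.snd_swap, Nat.gcd_comm x.2 x.1]

lemma Xc.swap_fst (x : Xc) : (Xc.swap x).1.1 = x.1.2 := rfl

lemma Xc.swap_size (x : Xc) : (Xc.swap x).size = x.size := add_comm _ _

lemma Xc.sum_ball_fst (K : ℕ) (g : ℕ → ℝ) :
    ∑ x ∈ Xc.ball K, (x.1.1 : ℝ) * g x.size = ∑ x ∈ Xc.ball K, (x.1.2 : ℝ) * g x.size := by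
  refine Finset.sum_equiv Xc.swap.symm (fun x => ?_) fun x _ => ?_
  · rw [Xc.mem_ball, Xc.mem_ball, ← Xc.swap_size (Xc.swap.symm x), Equiv.apply_symm_apply]
  · conv_lhs => rw [← Equiv.apply_symm_apply Xc.swap x]
    rw [Xc.swap_fst, Xc.swap_size]

lemma Xc.sum_ball_coord (K : ℕ) (g : ℕ → ℝ) :
    ∑ x ∈ Xc.ball K, (x.1.1 : ℝ) * g x.size = (∑ x ∈ Xc.ball K, (x.size : ℝ) * g x.size) / 2 ∧
    ∑ x ∈ Xc.ball K, (x.1.2 : ℝ) * g x.size = (∑ x ∈ Xc.ball K, (x.size : ℝ) * g x.size) / 2 := by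
  have h := Xc.sum_ball_fst K g
  have h2 : ∑ x ∈ Xc.ball K, (x.size : ℝ) * g x.size
      = ∑ x ∈ Xc.ball K, (x.1.1 : ℝ) * g x.size + ∑ x ∈ Xc.ball K, (x.1.2 : ℝ) * g x.size := by
    rw [← Finset.sum_add_distrib]
    exact Finset.sum_congr rfl fun x _ => by rw [Xc.size, Nat.cast_add, add_mul]
  constructor <;> linarith

lemma Xc.summable_coord {g : ℕ → ℝ} (hg : ∀ m, 0 ≤ g m)
    (hs : Summable fun x : Xc => (x.size : ℝ) * g x.size) :
    Summable (fun x : Xc => (x.1.1 : ℝ) * g x.size) ∧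
    Summable (fun x : Xc => (x.1.2 : ℝ) * g x.size) := by
  constructor <;>
  · refine Summable.of_nonneg_of_le (fun x => mul_nonneg (Nat.cast_nonneg _) (hg _))
      (fun x => ?_) hs
    refine mul_le_mul_of_nonneg_right ?_ (hg _)
    rw [Xc.size]
    exact_mod_cast (by omega)

lemma Xc.tsum_coord {g : ℕ → ℝ} (hg : ∀ m, 0 ≤ g m)
    (hs : Summable fun x : Xc => (x.size : ℝ) * g x.size) :
    ∑' x : Xc, (x.1.1 : ℝ) * g x.size = (∑' x : Xc, (x.size : ℝ) * g x.size) / 2 ∧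
    ∑' x : Xc, (x.1.2 : ℝ) * g x.size = (∑' x : Xc, (x.size : ℝ) * g x.size) / 2 := by
  have h := Xc.swap.tsum_eq fun x : Xc => (x.1.1 : ℝ) * g x.size
  simp only [Xc.swap_fst, Xc.swap_size] at h
  obtain ⟨s1, s2⟩ := Xc.summable_coord hg hs
  have h2 := s1.tsum_add s2
  have h3 : ∑' x : Xc, (x.size : ℝ) * g x.size
      = ∑' x : Xc, ((x.1.1 : ℝ) * g x.size + (x.1.2 : ℝ) * g x.size) :=
    tsum_congr fun x => by rw [Xc.size, Nat.cast_add, add_mul]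
  constructor <;> linarith

variable {l : ℝ} (hl : 0 < l)
include hl

/-- Asymptotics of the sums over all primitive vectors as `b → 0`. -/
lemma Xc.tendsto_stats :
    (∀ b > 0, Summable (fun x : Xc => logZ l (x.q b)) ∧ Summable (fun x : Xc => occP l (x.q b)) ∧
      Summable (fun x : Xc => (x.size : ℝ) * meanN l (x.q b)) ∧
      Summable fun x : Xc => (x.size : ℝ) ^ 2 * secM l (x.q b)) ∧
    Tendsto (fun b : ℝ => b ^ 2 * ∑' x : Xc, logZ l (x.q b)) (𝓝[>] 0) (𝓝 (Aint l / zeta2)) ∧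
    Tendsto (fun b : ℝ => b ^ 2 * ∑' x : Xc, occP l (x.q b)) (𝓝[>] 0) (𝓝 (Bint l / zeta2)) ∧
    Tendsto (fun b : ℝ => b ^ 3 * ∑' x : Xc, (x.size : ℝ) * meanN l (x.q b)) (𝓝[>] 0)
      (𝓝 (2 * (Aint l / zeta2))) ∧
    ∃ V : ℝ, Tendsto (fun b : ℝ => b ^ 4 * ∑' x : Xc, (x.size : ℝ) ^ 2 * secM l (x.q b))
      (𝓝[>] 0) (𝓝 V) := by
  obtain ⟨C, hC⟩ := exists_weight_bounds hl
  have hq := @exp_neg_lt_one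
  have hZ := Xc.tendsto_sum_mul (g := fun s => logZ l (exp (-s))) (C := C)
    (continuousOn_id.mul (continuousOn_logZ hl))
    (fun s hs => mul_nonneg hs.le (logZ_nonneg hl (exp_pos _) (hq hs)))
    (fun s hs => (hC s hs).2.2.1)
  have hP := Xc.tendsto_sum_mul (g := fun s => occP l (exp (-s))) (C := C)
    (continuousOn_id.mul (continuousOn_occP hl))
    (fun s hs => mul_nonneg hs.le (occP_pos hl (exp_pos _) (hq hs)).le)
    (fun s hs => (hC s hs).1)
  have eM : ∀ s : ℝ, s * (s * meanN l (exp (-s))) = s ^ 2 * meanN l (exp (-s)) := fun s => by ring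
  have eV : ∀ s : ℝ, s * (s ^ 2 * secM l (exp (-s))) = s ^ 3 * secM l (exp (-s)) :=
    fun s => by ring
  have hM := Xc.tendsto_sum_mul (g := fun s => s * meanN l (exp (-s))) (C := C)
    (continuousOn_id.mul (continuousOn_id.mul (continuousOn_meanN hl)))
    (fun s hs => mul_nonneg hs.le (mul_nonneg hs.le (meanN_pos hl (exp_pos _) (hq hs)).le))
    (fun s hs => by rw [eM]; exact (hC s hs).2.1)
  have hV := Xc.tendsto_sum_mul (g := fun s => s ^ 2 * secM l (exp (-s))) (C := C)
    (continuousOn_id.mul ((continuousOn_pow 2).mul (continuousOn_secM hl)))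
    (fun s hs => mul_nonneg hs.le (mul_nonneg (sq_nonneg s) (secM_pos hl (exp_pos _) (hq hs)).le))
    (fun s hs => by rw [eV]; exact (hC s hs).2.2.2)
  simp only [eM, ← two_mul_Aint_eq hl, mul_div_assoc] at hM
  rw [← Aint_eq_logZ hl] at hZ
  rw [← Bint_eq hl] at hP
  have fM : ∀ b : ℝ, ∀ x : Xc, b * x.size * meanN l (exp (-(b * x.size)))
      = b * ((x.size : ℝ) * meanN l (x.q b)) := fun b x => by rw [Xc.q]; ring
  have fV : ∀ b : ℝ, ∀ x : Xc, (b * x.size) ^ 2 * secM l (exp (-(b * x.size)))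
      = b ^ 2 * ((x.size : ℝ) ^ 2 * secM l (x.q b)) := fun b x => by rw [Xc.q]; ring
  simp only [fM, tsum_mul_left] at hM
  simp only [fV, tsum_mul_left] at hV
  refine ⟨fun b hb => ⟨hZ.1 b hb, hP.1 b hb, ?_, ?_⟩, hZ.2, hP.2, ?_,
    ⟨_, hV.2.congr fun b => by rw [← mul_assoc]; ring⟩⟩
  · exact (summable_mul_left_iff hb.ne').1 (hM.1 b hb)
  · exact (summable_mul_left_iff (pow_pos hb 2).ne').1 (hV.1 b hb)
  · refine hM.2.congr fun b => ?_
    rw [← mul_assoc]; ring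

lemma Aint_pos : 0 < Aint l := by
  obtain ⟨C, hC⟩ := exists_weight_bounds hl
  have h := two_mul_Aint_eq hl
  suffices 0 < ∫ s in Set.Ioi (0:ℝ), s ^ 2 * meanN l (exp (-s)) by linarith
  have hpos : ∀ s ∈ Set.Ioi (0:ℝ), 0 < s ^ 2 * meanN l (exp (-s)) := fun s hs =>
    mul_pos (pow_pos hs 2) (meanN_pos hl (exp_pos _) (exp_neg_lt_one hs))
  rw [setIntegral_pos_iff_support_of_nonneg_ae]
  · have hsub : Set.Ioi 0 ⊆ Function.support fun s => s ^ 2 * meanN l (exp (-s)) :=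
      fun s hs => (hpos s hs).ne'
    rw [Set.inter_eq_right.2 hsub]
    simp
  · exact (ae_restrict_iff' measurableSet_Ioi).2 (Eventually.of_forall fun s hs => (hpos s hs).le)
  · exact integrableOn_of_exp_bound ((continuousOn_pow 2).mul (continuousOn_meanN hl))
      (fun s hs => (hpos s hs).le) (fun s hs => (hC s hs).2.1)

lemma Bint_nonneg : 0 ≤ Bint l := by
  rw [Bint_eq hl]
  exact setIntegral_nonneg measurableSet_Ioi fun s hs =>
    mul_nonneg (le_of_lt hs) (occP_pos hl (exp_pos _) (exp_neg_lt_one hs)).le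

/-- Both used and unused vectors in a small ball are numerous. -/
lemma Xc.exists_ball_lower {η : ℝ} (hη : 0 < η) (hη1 : η ≤ 1) : ∃ c > 0, ∀ᶠ b in 𝓝[>] (0:ℝ),
    c ≤ b ^ 2 * ∑ x ∈ Xc.ball ⌊η / b⌋₊, occP l (x.q b) ∧
    c ≤ b ^ 2 * ((Xc.ball ⌊η / b⌋₊).card - ∑ x ∈ Xc.ball ⌊η / b⌋₊, occP l (x.q b)) := by
  obtain ⟨C, hC⟩ := exists_weight_bounds hl
  let p : ℝ → ℝ := fun s => occP l (exp (-s))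
  have hp0 : ∀ s > 0, 0 < p s := fun s hs => occP_pos hl (exp_pos _) (exp_neg_lt_one hs)
  have hp1 : ∀ s > 0, p s < 1 := fun s hs => occP_lt_one hl (exp_pos _) (exp_neg_lt_one hs)
  let T : ℝ → ℝ := fun s => max 0 (η - s) * (p s * (1 - p s))
  have hT0 : ∀ s > 0, 0 ≤ T s := fun s hs =>
    mul_nonneg (le_max_left _ _) (mul_nonneg (hp0 s hs).le (by linarith [hp1 s hs]))
  have hTle : ∀ s > 0, T s ≤ p s * (1 - p s) := fun s hs => by
    have h1 : max 0 (η - s) ≤ 1 := max_le zero_le_one (by linarith)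
    have h2 : 0 ≤ p s * (1 - p s) := mul_nonneg (hp0 s hs).le (by linarith [hp1 s hs])
    exact mul_le_of_le_one_left h2 h1
  have hTp : ∀ s > 0, T s ≤ p s := fun s hs =>
    (hTle s hs).trans (mul_le_of_le_one_right (hp0 s hs).le (by linarith [hp0 s hs]))
  have hTp' : ∀ s > 0, T s ≤ 1 - p s := fun s hs =>
    (hTle s hs).trans (mul_le_of_le_one_left (by linarith [hp1 s hs]) (hp1 s hs).le)
  have hTcont : ContinuousOn (fun s => s * T s) (Set.Ioi 0) := by
    have := continuousOn_occP hl
    refine continuousOn_id.mul (ContinuousOn.mul (by fun_prop) (this.mul ?_))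
    exact continuousOn_const.sub this
  have hTC : ∀ s > 0, s * T s ≤ C * exp (-s / 2) := fun s hs =>
    (mul_le_mul_of_nonneg_left (hTp s hs) hs.le).trans (hC s hs).1
  have hsT0 : ∀ s > 0, 0 ≤ s * T s := fun s hs => mul_nonneg hs.le (hT0 s hs)
  obtain ⟨hsum, hlim⟩ := Xc.tendsto_sum_mul hTcont hsT0 hTC
  have hI : 0 < ∫ s in Set.Ioi (0:ℝ), s * T s := by
    rw [setIntegral_pos_iff_support_of_nonneg_ae]
    · have hsub : Set.Ioo 0 η ⊆ Function.support (fun s => s * T s) ∩ Set.Ioi 0 := by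
        rintro s ⟨h1, h2⟩
        refine ⟨(mul_pos h1 (mul_pos (lt_max_of_lt_right (by linarith))
          (mul_pos (hp0 s h1) (by linarith [hp1 s h1])))).ne', h1⟩
      refine lt_of_lt_of_le ?_ (measure_mono hsub)
      simpa using hη
    · exact (ae_restrict_iff' measurableSet_Ioi).2 (Eventually.of_forall fun s hs => hsT0 s hs)
    · exact integrableOn_of_exp_bound hTcont hsT0 hTC
  have hz : 0 < zeta2 := by unfold zeta2; positivity
  set L := (∫ s in Set.Ioi (0:ℝ), s * T s) / zeta2
  have hL : 0 < L := div_pos hI hz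
  refine ⟨L / 2, half_pos hL, ?_⟩
  filter_upwards [self_mem_nhdsWithin, hlim.eventually (lt_mem_nhds (half_lt_self hL))]
    with b hb hbL
  have hb : 0 < b := hb
  have hpos : ∀ x : Xc, 0 < b * (x.size : ℝ) := fun x =>
    mul_pos hb (by exact_mod_cast x.size_pos)
  have htsum : ∑' x : Xc, T (b * x.size) = ∑ x ∈ Xc.ball ⌊η / b⌋₊, T (b * x.size) := by
    refine tsum_eq_sum fun x hx => ?_
    rw [Xc.mem_ball, not_le] at hx
    have h1 := Nat.lt_of_floor_lt hx
    rw [div_lt_iff₀ hb] at h1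
    have : max 0 (η - b * x.size) = 0 := max_eq_left (by linarith)
    simp only [T, this, zero_mul]
  rw [htsum] at hbL
  constructor
  · refine hbL.le.trans (mul_le_mul_of_nonneg_left ?_ (sq_nonneg b))
    exact Finset.sum_le_sum fun x _ => hTp _ (hpos x)
  · refine hbL.le.trans (mul_le_mul_of_nonneg_left ?_ (sq_nonneg b))
    rw [Finset.card_eq_sum_ones, Nat.cast_sum, ← Finset.sum_sub_distrib]
    refine Finset.sum_le_sum fun x _ => ?_
    rw [Nat.cast_one]
    exact hTp' _ (hpos x)

end Sums

section Asymptotics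

open Topology

lemma Xc.exp_neg_mul_size_lt_one {b : ℝ} (hb : 0 < b) (x : Xc) : x.q b < 1 :=
  exp_neg_lt_one (mul_pos hb (by exact_mod_cast x.size_pos))

lemma exists_superset_sum_ge {α : Type*} {f g h : α → ℝ} (hf : Summable f) (hg : Summable g)
    (hh : Summable h) {τ₁ τ₂ τ₃ : ℝ} (h₁ : 0 < τ₁) (h₂ : 0 < τ₂) (h₃ : 0 < τ₃) (R : Finset α) :
    ∃ G : Finset α, R ⊆ G ∧ ∑' x, f x - τ₁ ≤ ∑ x ∈ G, f x ∧ ∑' x, g x - τ₂ ≤ ∑ x ∈ G, g x ∧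
      ∑' x, h x - τ₃ ≤ ∑ x ∈ G, h x := by
  have e₁ := hf.hasSum.eventually (lt_mem_nhds (sub_lt_self _ h₁))
  have e₂ := hg.hasSum.eventually (lt_mem_nhds (sub_lt_self _ h₂))
  have e₃ := hh.hasSum.eventually (lt_mem_nhds (sub_lt_self _ h₃))
  obtain ⟨G, hR, g₁, g₂, g₃⟩ := ((eventually_ge_atTop R).and (e₁.and (e₂.and e₃))).exists
  exact ⟨G, hR, g₁.le, g₂.le, g₃.le⟩

variable {l : ℝ} (hl : 0 < l)
include hl

lemma eventually_numChains_le {ε : ℝ} (hε : 0 < ε) : ∀ᶠ b in 𝓝[>] (0:ℝ), ∀ n N : ℕ,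
    n * b ^ 3 = Aint l / zeta2 → Bint l / zeta2 - b ^ 2 ≤ N * b ^ 2 →
    N * b ^ 2 ≤ Bint l / zeta2 →
    (numChains n n N : ℝ) ≤
      exp ((3 * (Aint l / zeta2) - Bint l / zeta2 * Real.log l + ε) / b ^ 2) := by
  obtain ⟨hsum, hZ, -⟩ := Xc.tendsto_stats hl
  have hsmall : ∀ᶠ b in 𝓝[>] (0:ℝ), b ^ 2 * |Real.log l| < ε / 2 := by
    have h : Tendsto (fun b : ℝ => b ^ 2 * |Real.log l|) (𝓝[>] 0) (𝓝 (0 ^ 2 * |Real.log l|)) :=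
      ((continuous_pow 2).mul continuous_const).continuousAt.tendsto.mono_left nhdsWithin_le_nhds
    exact h.eventually (gt_mem_nhds (by simpa using hε))
  filter_upwards [self_mem_nhdsWithin, hsmall,
    hZ.eventually (gt_mem_nhds (lt_add_of_pos_right _ (half_pos hε)))] with b hb h1 h2 n N hn hN hN'
  have hb : 0 < b := hb
  have hb2 := pow_pos hb 2
  refine (numChains_le hl hb n N).trans (Real.exp_le_exp.2 ?_)
  have h3 : ∑ x ∈ Xc.ball (n + n), logZ l (x.q b) ≤ ∑' x : Xc, logZ l (x.q b) :=
    (hsum b hb).1.sum_le_tsum _ fun x _ =>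
      logZ_nonneg hl (exp_pos _) (Xc.exp_neg_mul_size_lt_one hb x)
  have h4 : (Bint l / zeta2 - N * b ^ 2) * Real.log l ≤ b ^ 2 * |Real.log l| := by
    refine (le_abs_self _).trans ?_
    rw [abs_mul, abs_of_nonneg (by linarith)]
    exact mul_le_mul_of_nonneg_right (by linarith) (abs_nonneg _)
  have h5 := mul_le_mul_of_nonneg_left h3 hb2.le
  rw [le_div_iff₀ hb2]
  change (∑ x ∈ Xc.ball (n + n), logZ l (x.q b) + _ - _) * _ ≤ _
  linarith

lemma eventually_le_numChains {ε : ℝ} (hε : 0 < ε) : ∀ᶠ b in 𝓝[>] (0:ℝ), ∀ n N : ℕ,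
    n * b ^ 3 = Aint l / zeta2 → Bint l / zeta2 - b ^ 2 ≤ N * b ^ 2 →
    N * b ^ 2 ≤ Bint l / zeta2 →
    exp ((3 * (Aint l / zeta2) - Bint l / zeta2 * Real.log l - ε) / b ^ 2)
      ≤ (numChains n n N : ℝ) := by
  classical
  obtain ⟨hsum, hZ, hP, hM, V, hV⟩ := Xc.tendsto_stats hl
  obtain ⟨C, hC⟩ := exists_weight_bounds hl
  have hC0 : 0 ≤ C := nonneg_of_mul_nonneg_left
    ((mul_pos one_pos (occP_pos hl (exp_pos _) (exp_neg_lt_one one_pos))).le.trans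
      (hC 1 one_pos).1) (exp_pos _)
  set a₀ := Aint l / zeta2
  set b₀ := Bint l / zeta2
  set L := |Real.log l|
  obtain ⟨η, hη, hη4, hηε⟩ : ∃ η > 0, η ≤ 1 / 4 ∧ 2 * C * η * (2 + L) ≤ ε / 2 := by
    refine ⟨min (1 / 4) (ε / (4 * (C + 1) * (2 + L))), lt_min (by norm_num) (by positivity),
      min_le_left _ _, ?_⟩
    have h1 := min_le_right (1 / 4) (ε / (4 * (C + 1) * (2 + L)))
    rw [le_div_iff₀ (by positivity)] at h1
    have h2 : 0 < min (1 / 4) (ε / (4 * (C + 1) * (2 + L))) :=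
      lt_min (by norm_num) (by positivity)
    have h3 : 0 ≤ min (1 / 4) (ε / (4 * (C + 1) * (2 + L))) * (2 + L) := by positivity
    nlinarith
  obtain ⟨c, hc, hball⟩ := Xc.exists_ball_lower hl hη (by linarith)
  obtain ⟨δ, hδ, hδc, hδε⟩ : ∃ δ > 0, 12 * δ ≤ c ∧ δ * (7 + 3 * L) ≤ ε / 2 := by
    refine ⟨min (c / 12) (ε / (2 * (7 + 3 * L))), lt_min (by positivity) (by positivity), ?_, ?_⟩
    · linarith [min_le_left (c / 12) (ε / (2 * (7 + 3 * L)))]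
    · have h1 := min_le_right (c / 12) (ε / (2 * (7 + 3 * L)))
      rw [le_div_iff₀ (by positivity)] at h1
      linarith
  have hsq : ∀ A κ : ℝ, 0 < κ → ∀ᶠ b in 𝓝[>] (0:ℝ), b ^ 2 * A < κ := by
    intro A κ hκ
    have h : Tendsto (fun b : ℝ => b ^ 2 * A) (𝓝[>] 0) (𝓝 (0 ^ 2 * A)) :=
      ((continuous_pow 2).mul continuous_const).continuousAt.tendsto.mono_left nhdsWithin_le_nhds
    exact h.eventually (gt_mem_nhds (by simpa using hκ))
  filter_upwards [self_mem_nhdsWithin, hball, hsq 3 δ hδ, hsq (V + 1) (δ ^ 2 / 6) (by positivity),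
    hsq (b₀ + δ) (δ ^ 2 / 6) (by positivity), hsq (Real.log 2) δ hδ,
    (gt_mem_nhds hη : ∀ᶠ b in 𝓝 (0:ℝ), b < η).filter_mono nhdsWithin_le_nhds,
    hZ.eventually (lt_mem_nhds (sub_lt_self a₀ hδ)),
    hP.eventually (lt_mem_nhds (sub_lt_self b₀ hδ)),
    hP.eventually (gt_mem_nhds (lt_add_of_pos_right b₀ hδ)),
    hM.eventually (lt_mem_nhds (sub_lt_self (2 * a₀) hδ)),
    hM.eventually (gt_mem_nhds (lt_add_of_pos_right (2 * a₀) hδ)),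
    hV.eventually (gt_mem_nhds (lt_add_one V))]
    with b hb hb_ball hb3 hbV hbP hb2log hbη hbZ hbP1 hbP2 hbM1 hbM2 hbV2 n N hn hN1 hN2
  have hb : 0 < b := hb
  have hb2 : 0 < b ^ 2 := pow_pos hb 2
  have hb3' : 0 < b ^ 3 := pow_pos hb 3
  set K := ⌊η / b⌋₊
  set R := Xc.ball K
  have hK1 : 1 ≤ K := Nat.le_floor (by rw [Nat.cast_one, le_div_iff₀ hb]; linarith)
  have hbK : b * K ≤ η := by
    have := Nat.floor_le (div_pos hη hb).le
    rw [le_div_iff₀ hb] at this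
    linarith
  obtain ⟨sZ, sP, sM, sV⟩ := hsum b hb
  have q1 := Xc.exp_neg_mul_size_lt_one hb
  have pP : ∀ x : Xc, 0 ≤ occP l (x.q b) := fun x => (occP_pos hl (exp_pos _) (q1 x)).le
  have pM : ∀ x : Xc, 0 ≤ meanN l (x.q b) := fun x => (meanN_pos hl (exp_pos _) (q1 x)).le
  have pV : ∀ x : Xc, 0 ≤ secM l (x.q b) := fun x => (secM_pos hl (exp_pos _) (q1 x)).le
  obtain ⟨G, hRG, gZ, gP, gM⟩ := exists_superset_sum_ge sZ sP sM (τ₁ := δ / b ^ 2)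
    (τ₂ := δ / b ^ 2) (τ₃ := δ / b ^ 3) (by positivity) (by positivity) (by positivity) R
  have hdisj : Disjoint (G \ R) R := Finset.sdiff_disjoint
  have split : ∀ f : Xc → ℝ, ∑ x ∈ G \ R, f x = ∑ x ∈ G, f x - ∑ x ∈ R, f x := fun f =>
    eq_sub_of_add_eq (Finset.sum_sdiff hRG)
  -- sums over the ball are negligible
  have rZ : b ^ 2 * ∑ x ∈ R, logZ l (x.q b) ≤ 2 * C * η := by
    have h := Xc.sum_ball_le (g := fun s => logZ l (exp (-s))) hC0 hb
      (fun s hs => (hC s hs).2.2.1) K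
    calc b ^ 2 * ∑ x ∈ R, logZ l (x.q b) ≤ b ^ 2 * (2 * C * K / b) :=
          mul_le_mul_of_nonneg_left h hb2.le
      _ = 2 * C * (b * K) := by field_simp
      _ ≤ 2 * C * η := by gcongr
  have rM : b ^ 3 * ∑ x ∈ R, (x.size : ℝ) * meanN l (x.q b) ≤ 2 * C * η := by
    have h := Xc.sum_ball_le (g := fun s => s * meanN l (exp (-s))) hC0 hb
      (fun s hs => by rw [← mul_assoc, ← pow_two]; exact (hC s hs).2.1) K
    have e : ∑ x ∈ Xc.ball K, b * x.size * meanN l (exp (-(b * x.size)))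
        = b * ∑ x ∈ R, (x.size : ℝ) * meanN l (x.q b) := by
      rw [Finset.mul_sum]; exact Finset.sum_congr rfl fun x _ => by rw [Xc.q, mul_assoc]
    rw [e] at h
    calc b ^ 3 * ∑ x ∈ R, (x.size : ℝ) * meanN l (x.q b)
        = b ^ 2 * (b * ∑ x ∈ R, (x.size : ℝ) * meanN l (x.q b)) := by ring
      _ ≤ b ^ 2 * (2 * C * K / b) := mul_le_mul_of_nonneg_left h hb2.le
      _ = 2 * C * (b * K) := by field_simp
      _ ≤ 2 * C * η := by gcongr
  have rMP : b ^ 2 * ∑ x ∈ R, occP l (x.q b)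
      ≤ b ^ 3 * ∑ x ∈ R, (x.size : ℝ) * meanN l (x.q b) := by
    rw [Finset.mul_sum, Finset.mul_sum]
    refine Finset.sum_le_sum fun x _ => ?_
    have h1q : 0 < 1 - x.q b := by linarith [q1 x]
    have h2 : 1 - x.q b ≤ b * x.size := by
      have := Real.add_one_le_exp (-(b * (x.size : ℝ)))
      change 1 - exp (-(b * x.size)) ≤ _
      linarith
    have h3 : occP l (x.q b) = (1 - x.q b) * meanN l (x.q b) := by
      rw [meanN_eq, mul_div_cancel₀ _ h1q.ne']
    rw [h3]
    calc b ^ 2 * ((1 - x.q b) * meanN l (x.q b)) ≤ b ^ 2 * ((b * x.size) * meanN l (x.q b)) := by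
          gcongr
          exact pM x
      _ = _ := by ring
  obtain ⟨cR₁, cR₂⟩ := hb_ball
  set ZR := ∑ x ∈ R, logZ l (x.q b)
  set PR := ∑ x ∈ R, occP l (x.q b)
  set MR := ∑ x ∈ R, (x.size : ℝ) * meanN l (x.q b)
  -- coordinates
  let g : ℕ → ℝ := fun m => meanN l (exp (-(b * m)))
  have hg : ∀ x : Xc, g x.size = meanN l (x.q b) := fun x => rfl
  have hg0 : ∀ m, 0 ≤ g m := by
    intro m
    rcases Nat.eq_zero_or_pos m with rfl | hm
    · simp [g, meanN]
    · exact (meanN_pos hl (exp_pos _)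
        (exp_neg_lt_one (mul_pos hb (by exact_mod_cast hm)))).le
  have coordR := Xc.sum_ball_coord K g
  have coordS := Xc.summable_coord hg0 sM
  have coordT := Xc.tsum_coord hg0 sM
  simp only [hg] at coordR coordS coordT
  have cG₁ := coordS.1.sum_le_tsum G fun x _ => mul_nonneg (Nat.cast_nonneg _) (pM x)
  have cG₂ := coordS.2.sum_le_tsum G fun x _ => mul_nonneg (Nat.cast_nonneg _) (pM x)
  rw [coordT.1] at cG₁
  rw [coordT.2] at cG₂
  have gP' := sP.sum_le_tsum G fun x _ => pP x
  set ZT := ∑' x : Xc, logZ l (x.q b)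
  set PT := ∑' x : Xc, occP l (x.q b)
  set MT := ∑' x : Xc, (x.size : ℝ) * meanN l (x.q b)
  set PF := ∑ x ∈ G \ R, occP l (x.q b)
  have ePF : PF = ∑ x ∈ G, occP l (x.q b) - PR := split _
  have d2 : b ^ 2 * (δ / b ^ 2) = δ := mul_div_cancel₀ _ hb2.ne'
  have d3 : b ^ 3 * (δ / b ^ 3) = δ := mul_div_cancel₀ _ hb3'.ne'
  have uP : b ^ 2 * PF ≤ b ^ 2 * PT - b ^ 2 * PR := by
    rw [← mul_sub]; exact mul_le_mul_of_nonneg_left (by linarith) hb2.le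
  have lP : b ^ 2 * PT - δ - b ^ 2 * PR ≤ b ^ 2 * PF := by
    have := mul_le_mul_of_nonneg_left gP hb2.le
    rw [mul_sub, d2] at this
    rw [ePF, mul_sub]
    linarith
  have hcoord : ∀ y : Xc → ℝ, ∑ x ∈ G, y x * meanN l (x.q b) ≤ MT / 2 →
      ∑ x ∈ R, y x * meanN l (x.q b) = MR / 2 →
      (N - PF + δ / b ^ 2) * K ≤ n - ∑ x ∈ G \ R, y x * meanN l (x.q b) - δ / b ^ 3 := by
    intro y hy1 hy2
    rw [split, hy2]
    refine le_of_mul_le_mul_left ?_ hb3'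
    have e1 : b ^ 3 * ((N - PF + δ / b ^ 2) * K)
        = (N * b ^ 2 - b ^ 2 * PF + b ^ 2 * (δ / b ^ 2)) * (b * K) := by ring
    have e2 : (N * b ^ 2 - b ^ 2 * PF + b ^ 2 * (δ / b ^ 2)) * (b * K)
        ≤ (b ^ 2 * PR + 3 * δ) * (1 / 4) := by
      rw [d2]
      refine mul_le_mul (by linarith) (by linarith) (by positivity) (by linarith)
    have e3 := mul_le_mul_of_nonneg_left hy1 hb3'.le
    rw [e1]
    refine e2.trans ?_
    have e4 : b ^ 3 * (n - (∑ x ∈ G, y x * meanN l (x.q b) - MR / 2) - δ / b ^ 3)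
        = n * b ^ 3 - b ^ 3 * ∑ x ∈ G, y x * meanN l (x.q b) + b ^ 3 * MR / 2
          - b ^ 3 * (δ / b ^ 3) := by ring
    rw [e4, d3, hn]
    linarith
  have key := le_numChains (n := n) (N := N) hl hb hdisj hK1 (t₁ := δ / b ^ 3) (t₂ := δ / b ^ 2)
    (by positivity) (by positivity) ?_ ?_ ?_ ?_ (hcoord _ cG₁ coordR.1) (hcoord _ cG₂ coordR.2)
  · refine le_trans ?_ key
    rw [le_div_iff₀ two_pos]
    conv_lhs => rw [← Real.exp_log two_pos]
    rw [← Real.exp_add]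
    refine Real.exp_le_exp.2 (le_of_mul_le_mul_left ?_ hb2)
    have k1 : b ^ 2 * ∑ x ∈ G \ R, logZ l (x.q b) ≥ a₀ - 2 * δ - 2 * C * η := by
      have := mul_le_mul_of_nonneg_left gZ hb2.le
      rw [mul_sub, d2] at this
      rw [split, mul_sub]
      linarith
    have k2 : b ^ 3 * ∑ x ∈ G \ R, (x.size : ℝ) * meanN l (x.q b)
        ≥ 2 * a₀ - 2 * δ - 2 * C * η := by
      have := mul_le_mul_of_nonneg_left gM hb3'.le
      rw [mul_sub, d3] at this
      rw [split, mul_sub]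
      linarith
    have k3 : (b ^ 2 * PF - b₀) * Real.log l ≤ (2 * δ + 2 * C * η) * L := by
      refine (le_abs_self _).trans ?_
      rw [abs_mul]
      refine mul_le_mul_of_nonneg_right (abs_le.2 ⟨by linarith, ?_⟩) (abs_nonneg _)
      have : 0 ≤ 2 * C * η := by positivity
      linarith
    have k4 : b ^ 2 * ((3 * a₀ - b₀ * Real.log l - ε) / b ^ 2 + Real.log 2)
        = 3 * a₀ - b₀ * Real.log l - ε + b ^ 2 * Real.log 2 := by
      rw [mul_add, mul_div_cancel₀ _ hb2.ne']
    have k5 : b ^ 2 * (∑ x ∈ G \ R, logZ l (x.q b)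
        + b * ∑ x ∈ G \ R, (x.size : ℝ) * meanN l (x.q b)
        - PF * Real.log l - 2 * (b * (δ / b ^ 3)) - δ / b ^ 2 * L)
        = b ^ 2 * ∑ x ∈ G \ R, logZ l (x.q b)
        + b ^ 3 * ∑ x ∈ G \ R, (x.size : ℝ) * meanN l (x.q b)
        - b ^ 2 * PF * Real.log l - 2 * (b ^ 3 * (δ / b ^ 3)) - b ^ 2 * (δ / b ^ 2) * L := by ring
    rw [k4, k5, d2, d3]
    linarith
  · have h1 := sV.sum_le_tsum (G \ R) fun x _ => mul_nonneg (sq_nonneg _) (pV x)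
    refine h1.trans (le_of_mul_le_mul_left ?_ (pow_pos hb 6))
    have e : b ^ 6 * ((δ / b ^ 3) ^ 2 / 6) = (b ^ 3 * (δ / b ^ 3)) ^ 2 / 6 := by ring
    rw [e, d3]
    have h2 := mul_le_mul_of_nonneg_left hbV2.le hb2.le
    have e2 : ∀ W : ℝ, b ^ 6 * W = b ^ 2 * (b ^ 4 * W) := fun W => by ring
    rw [e2]
    linarith
  · refine le_of_mul_le_mul_left ?_ (pow_pos hb 4)
    have e : b ^ 4 * ((δ / b ^ 2) ^ 2 / 6) = (b ^ 2 * (δ / b ^ 2)) ^ 2 / 6 := by ring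
    rw [e, d2]
    have e2 : ∀ W : ℝ, b ^ 4 * W = b ^ 2 * (b ^ 2 * W) := fun W => by ring
    rw [e2]
    have h2 : b ^ 2 * (b ^ 2 * PF) ≤ b ^ 2 * (b₀ + δ) :=
      mul_le_mul_of_nonneg_left (by linarith) hb2.le
    linarith
  · refine le_of_mul_le_mul_left ?_ hb2
    have e : b ^ 2 * (PF + δ / b ^ 2 + 2) = b ^ 2 * PF + b ^ 2 * (δ / b ^ 2) + 2 * b ^ 2 := by ring
    rw [e, d2]
    linarith
  · refine le_of_mul_le_mul_left ?_ hb2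
    have e : b ^ 2 * (PF - δ / b ^ 2 + (R.card : ℝ))
        = b ^ 2 * PF - b ^ 2 * (δ / b ^ 2) + b ^ 2 * R.card := by ring
    rw [e, d2]
    rw [mul_sub] at cR₂
    linarith

end Asymptotics

lemma zeta2_pos : 0 < zeta2 := by unfold zeta2; positivity

/-- For every `λ > 0`, `ln 𝒩(n, n, ⌊c(λ) n^{2/3}⌋) = n^{2/3}·(e(λ) + o(1))` as `n → ∞`. -/
theorem statement1 (l : ℝ) (hl : 0 < l) :
    (fun n : ℕ =>
        Real.log (numChains n n ⌊cfun l * (n : ℝ) ^ ((2:ℝ)/3)⌋₊)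
          - (n : ℝ) ^ ((2:ℝ)/3) * efun l)
      =o[atTop] (fun n : ℕ => (n : ℝ) ^ ((2:ℝ)/3)) := by
  have ha : 0 < Aint l / zeta2 := div_pos (Aint_pos hl) zeta2_pos
  set a := Aint l / zeta2 with ha_def
  have hA : Aint l = a * zeta2 := by rw [ha_def]; field_simp [zeta2_pos.ne']
  have hz : zeta2 ^ ((1:ℝ)/3) * zeta2 ^ ((2:ℝ)/3) = zeta2 := by
    rw [← rpow_add zeta2_pos]; norm_num
  have hc : cfun l * a ^ ((2:ℝ)/3) = Bint l / zeta2 := by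
    have h1 : 0 < a ^ ((2:ℝ)/3) := rpow_pos_of_pos ha _
    unfold cfun
    rw [hA, mul_rpow ha.le zeta2_pos.le]
    conv_rhs => rw [← hz]
    field_simp
  have hc0 : 0 ≤ cfun l :=
    div_nonneg (Bint_nonneg hl)
      (mul_nonneg (rpow_nonneg zeta2_pos.le _) (rpow_nonneg (Aint_pos hl).le _))
  have he : efun l * a ^ ((2:ℝ)/3) = 3 * a - Bint l / zeta2 * Real.log l := by
    have h1 : a ^ ((1:ℝ)/3) * a ^ ((2:ℝ)/3) = a := by rw [← rpow_add ha]; norm_num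
    unfold efun
    rw [← hc, sub_mul, mul_assoc, h1]; ring
  have hlim : Tendsto (fun n : ℕ => (a / (n : ℝ)) ^ ((1:ℝ)/3)) atTop (nhdsWithin 0 (Set.Ioi 0)) := by
    refine tendsto_nhdsWithin_iff.2 ⟨?_, ?_⟩
    · have h := (tendsto_const_div_atTop_nhds_zero_nat a).rpow_const
        (p := (1:ℝ)/3) (Or.inr (by norm_num))
      rwa [zero_rpow (by norm_num)] at h
    · filter_upwards [eventually_gt_atTop 0] with n hn
      have : (0:ℝ) < n := by exact_mod_cast hn
      exact rpow_pos_of_pos (div_pos ha this) _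
  have hap : 0 < a ^ ((2:ℝ)/3) := rpow_pos_of_pos ha _
  rw [isLittleO_iff]
  intro c hc1
  have hε : 0 < c * a ^ ((2:ℝ)/3) := mul_pos hc1 hap
  filter_upwards [hlim.eventually (eventually_numChains_le hl hε),
    hlim.eventually (eventually_le_numChains hl hε), eventually_gt_atTop 0] with n hup hlow hn
  have hn0 : (0:ℝ) < n := by exact_mod_cast hn
  have han : 0 < a / n := div_pos ha hn0
  set b := (a / (n:ℝ)) ^ ((1:ℝ)/3) with hb_def
  have hb0 : 0 < b := rpow_pos_of_pos han _
  have hb3 : (n:ℝ) * b ^ 3 = a := by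
    rw [hb_def, ← rpow_natCast, ← rpow_mul han.le]
    norm_num
    field_simp
  have hb2 : (n:ℝ) ^ ((2:ℝ)/3) * b ^ 2 = a ^ ((2:ℝ)/3) := by
    rw [hb_def, ← rpow_natCast, ← rpow_mul han.le, ← hb3, hb3]
    norm_num
    rw [← mul_rpow hn0.le han.le, mul_div_cancel₀ _ hn0.ne']
  have hb2' : 0 < b ^ 2 := by positivity
  have hm0 : 0 ≤ (n:ℝ) ^ ((2:ℝ)/3) := rpow_nonneg hn0.le _
  have hcn : cfun l * (n:ℝ) ^ ((2:ℝ)/3) * b ^ 2 = Bint l / zeta2 := by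
    rw [mul_assoc, hb2, hc]
  set N := ⌊cfun l * (n:ℝ) ^ ((2:ℝ)/3)⌋₊
  have hN1 : (N:ℝ) * b ^ 2 ≤ Bint l / zeta2 := by
    rw [← hcn]
    exact mul_le_mul_of_nonneg_right (Nat.floor_le (mul_nonneg hc0 hm0)) hb2'.le
  have hN2 : Bint l / zeta2 - b ^ 2 ≤ N * b ^ 2 := by
    rw [← hcn]
    nlinarith [Nat.lt_floor_add_one (cfun l * (n:ℝ) ^ ((2:ℝ)/3))]
  have hu := hup n N hb3 hN2 hN1
  have hlo := hlow n N hb3 hN2 hN1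
  have hpos : (0:ℝ) < numChains n n N := (exp_pos _).trans_le hlo
  have hu' := (log_le_iff_le_exp hpos).2 hu
  have hlo' := (le_log_iff_exp_le hpos).2 hlo
  have hm : (n:ℝ) ^ ((2:ℝ)/3) = a ^ ((2:ℝ)/3) / b ^ 2 := by rw [← hb2]; field_simp
  have hE : (n:ℝ) ^ ((2:ℝ)/3) * efun l = (3 * a - Bint l / zeta2 * Real.log l) / b ^ 2 := by
    rw [hm, ← he]; ring
  rw [norm_eq_abs, norm_eq_abs, abs_of_nonneg hm0, hE, hm, abs_le]
  rw [add_div, mul_div_assoc c, ← ha_def] at hu'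
  rw [sub_div _ (c * _), mul_div_assoc c, ← ha_def] at hlo'
  constructor <;> linarith
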